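/- arXiv:2107.14562 — 3 statements merged into one kernel-verified Lean document; each statement's English description precedes it below -/
import Mathlib

section
/- The Gaussian expectation ⟨𝒜^{1,3}(ξ)⟩₀ equals α² ∂_i ∂_j D^{ij} (the double divergence of D at x₀ multiplied by α²). -/
open MeasureTheory Real

/-- Partial derivative `∂_k f` of a scalar field on `ℝ^d`, at a point. -/
noncomputable def pd {d : ℕ} (f : (Fin d → ℝ) → ℝ) (k : Fin d) (x : Fin d → ℝ) : ℝ :=
  fderiv ℝ f x (Pi.single k 1)

/-- Second partial derivative `∂_i ∂_j f` of a scalar field on `ℝ^d`, at a point. -/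
noncomputable def pd2 {d : ℕ} (f : (Fin d → ℝ) → ℝ) (i j : Fin d) (x : Fin d → ℝ) : ℝ :=
  pd (fun y => pd f j y) i x

/-- The Gaussian density `p₀(ξ) = ((4π)^d det D)^{-1/2} exp(−¼ ξᵀ D⁻¹ ξ)`. -/
noncomputable def gaussDensity (d : ℕ) (D : Matrix (Fin d) (Fin d) ℝ)
    (ξ : Fin d → ℝ) : ℝ :=
  (Real.sqrt ((4 * π) ^ d * D.det))⁻¹ *
    Real.exp (-(1/4) * ∑ i, ∑ j, ξ i * D⁻¹ i j * ξ j)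

/-- The polynomial `𝒜^{1,3}(ξ) = −(α²/8)(D⁻¹(∂_i ∂_j D)D⁻¹)_{lm} ξ^i ξ^j ξ^l ξ^m
    + α² D⁻¹_{ij}(∂_k ∂_l D^{ik}) ξ^j ξ^l + (α²/4) tr(D⁻¹ ∂_i ∂_j D) ξ^i ξ^j`,
    all fields evaluated at `x₀`. -/
noncomputable def A13 (d : ℕ) (α : ℝ)
    (D : (Fin d → ℝ) → Matrix (Fin d) (Fin d) ℝ) (x₀ : Fin d → ℝ)
    (ξ : Fin d → ℝ) : ℝ :=
  -(α^2/8) * (∑ i, ∑ j, ∑ l, ∑ m,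
      (∑ a, ∑ b, (D x₀)⁻¹ l a * pd2 (fun x => D x a b) i j x₀ * (D x₀)⁻¹ b m) *
        ξ i * ξ j * ξ l * ξ m)
  + α^2 * (∑ j, ∑ l,
      (∑ i, ∑ k, (D x₀)⁻¹ i j * pd2 (fun x => D x i k) k l x₀) * ξ j * ξ l)
  + (α^2/4) * (∑ i, ∑ j,
      (∑ a, ∑ b, (D x₀)⁻¹ a b * pd2 (fun x => D x b a) i j x₀) * ξ i * ξ j)

open ProbabilityTheory Matrix
open scoped MatrixOrder

/-- A finite product of standard Gaussian measures has the product of the densities as density. -/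
theorem pi_gaussianReal_eq_withDensity (ι : Type*) [Fintype ι] :
    Measure.pi (fun _ : ι => gaussianReal 0 1) =
      (volume : Measure (ι → ℝ)).withDensity
        (fun y => ENNReal.ofReal (∏ i, gaussianPDFReal 0 1 (y i))) := by
  refine Measure.pi_eq fun s hs => ?_
  have hint : Integrable (fun y : ι → ℝ => ∏ i, gaussianPDFReal 0 1 (y i)) volume :=
    Integrable.fintype_prod fun _ => integrable_gaussianPDFReal 0 1
  rw [withDensity_apply _ (MeasurableSet.univ_pi hs),
    ← ofReal_integral_eq_lintegral_ofReal hint.restrict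
      (Filter.Eventually.of_forall fun y =>
        Finset.prod_nonneg fun i _ => gaussianPDFReal_nonneg 0 1 (y i)),
    volume_pi, Measure.restrict_pi_pi,
    integral_fintype_prod_eq_prod (fun _ => gaussianPDFReal 0 1),
    ENNReal.ofReal_prod_of_nonneg fun i _ =>
      integral_nonneg fun y => gaussianPDFReal_nonneg 0 1 y]
  exact Finset.prod_congr rfl fun i _ =>
    (gaussianReal_apply_eq_integral 0 one_ne_zero (s i)).symm

/-- The fourth moment of a centered real Gaussian distribution. -/
theorem integral_pow_four_gaussianReal (v : NNReal) :
    ∫ x, x ^ 4 ∂(gaussianReal 0 v) = 3 * (v : ℝ) ^ 2 := by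
  have key : ∫ x, x ^ 4 ∂(gaussianReal 0 v) =
      iteratedDeriv 4 (mgf (fun x ↦ x) (gaussianReal 0 v)) 0 := by
    rw [iteratedDeriv_mgf_zero] <;> simp
  have he (t : ℝ) : HasDerivAt (fun t : ℝ => rexp (v * t ^ 2 / 2))
      (rexp (v * t ^ 2 / 2) * (v * t)) t := by
    have := (((hasDerivAt_id t).pow 2).const_mul (v : ℝ)).div_const 2
    convert! this.exp using 1
    simp
    ring
  have h (p p' : ℝ → ℝ) (hp : ∀ t, HasDerivAt p (p' t) t) :
      deriv (fun t => p t * rexp (v * t ^ 2 / 2)) =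
        fun t => (p' t + v * t * p t) * rexp (v * t ^ 2 / 2) := by
    ext t
    refine ((hp t).mul (he t)).deriv.trans ?_
    ring
  have hid (c : ℝ) (n : ℕ) (t : ℝ) : HasDerivAt (fun t : ℝ => c * t ^ n) (c * (n * t ^ (n - 1))) t :=
    (hasDerivAt_pow n t).const_mul c
  have h0 : mgf (fun x ↦ x) (gaussianReal 0 v) = fun t => (1 : ℝ) * rexp (v * t ^ 2 / 2) := by
    rw [mgf_fun_id_gaussianReal]
    simp
  rw [key, iteratedDeriv_succ, iteratedDeriv_succ, iteratedDeriv_succ, iteratedDeriv_one, h0,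
    h (fun _ => 1) (fun _ => 0) (fun t => hasDerivAt_const t 1),
    h (fun t => 0 + v * t * 1) (fun _ => v) (fun t => by simpa using hid v 1 t),
    h (fun t => v + v * t * (0 + v * t * 1)) (fun t => v ^ 2 * (2 * t))
      (fun t => by
        convert! (hid (v ^ 2) 2 t).const_add (v : ℝ) using 1
        · ext; ring
        · simp),
    h (fun t => v ^ 2 * (2 * t) + v * t * (v + v * t * (0 + v * t * 1)))
      (fun t => 3 * v ^ 2 + v ^ 3 * (3 * t ^ 2))
      (fun t => by
        convert! (hid (3 * v ^ 2) 1 t).add (hid (v ^ 3) 3 t) using 1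
        · ext; simp; ring
        · simp)]
  simp

section Isserlis

variable {E : Type*} [NormedAddCommGroup E] [NormedSpace ℝ E] [MeasurableSpace E] [BorelSpace E]
  (μ : Measure E) [IsGaussian μ]

theorem IsGaussian.integral_dual_pow_four (L : StrongDual ℝ E) (hL : ∫ x, L x ∂μ = 0) :
    ∫ x, L x ^ 4 ∂μ = 3 * (∫ x, L x ^ 2 ∂μ) ^ 2 := by
  have hmap := IsGaussian.map_eq_gaussianReal (μ := μ) L
  rw [hL] at hmap
  have hm : AEMeasurable L μ := by fun_prop
  have h := integral_map (μ := μ) (φ := L) hm (f := fun x : ℝ => x ^ 4) (by fun_prop)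
  rw [← h, hmap, integral_pow_four_gaussianReal, Real.coe_toNNReal _ (variance_nonneg _ _),
    variance_of_integral_eq_zero hm hL]

theorem IsGaussian.integrable_dual_mul (L₁ L₂ : StrongDual ℝ E) :
    Integrable (fun x => L₁ x * L₂ x) μ :=
  (IsGaussian.memLp_dual μ L₁ 2 (by simp)).integrable_mul (IsGaussian.memLp_dual μ L₂ 2 (by simp))

theorem IsGaussian.integrable_dual_pow_four (L : StrongDual ℝ E) :
    Integrable (fun x => L x ^ 4) μ := by
  have h := (IsGaussian.memLp_dual μ L (4 : ℕ) (by simp)).integrable_norm_pow'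
  simpa only [Real.norm_eq_abs, Even.pow_abs (by decide : Even 4)] using h

/-- Polarization identity for quartic forms. -/
theorem mul_four_eq_polarization (x y z w : ℝ) :
    x * y * z * w = 1 / 192 *
      ((x + 1 * y + 1 * z + 1 * w) ^ 4 - (x + 1 * y + 1 * z + (-1) * w) ^ 4
      - (x + 1 * y + (-1) * z + 1 * w) ^ 4 + (x + 1 * y + (-1) * z + (-1) * w) ^ 4
      - (x + (-1) * y + 1 * z + 1 * w) ^ 4 + (x + (-1) * y + 1 * z + (-1) * w) ^ 4
      + (x + (-1) * y + (-1) * z + 1 * w) ^ 4 - (x + (-1) * y + (-1) * z + (-1) * w) ^ 4) := by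
  ring

theorem IsGaussian.integrable_dual_mul_four (X Y Z W : StrongDual ℝ E) :
    Integrable (fun x => X x * Y x * Z x * W x) μ := by
  have h (a b c : ℝ) : Integrable (fun x => (X x + a * Y x + b * Z x + c * W x) ^ 4) μ :=
    IsGaussian.integrable_dual_pow_four μ (X + a • Y + b • Z + c • W)
  simp_rw [mul_four_eq_polarization]
  exact ((((((((h _ _ _).sub (h _ _ _)).sub (h _ _ _)).add (h _ _ _)).sub (h _ _ _)).add
    (h _ _ _)).add (h _ _ _)).sub (h _ _ _)).const_mul _

/-- **Isserlis' theorem** (Wick's formula) for fourth moments of a centered Gaussian measure. -/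
theorem IsGaussian.integral_dual_mul_four (h0 : ∀ L : StrongDual ℝ E, ∫ x, L x ∂μ = 0)
    (X Y Z W : StrongDual ℝ E) :
    ∫ x, X x * Y x * Z x * W x ∂μ =
      (∫ x, X x * Y x ∂μ) * (∫ x, Z x * W x ∂μ) + (∫ x, X x * Z x ∂μ) * (∫ x, Y x * W x ∂μ)
        + (∫ x, X x * W x ∂μ) * (∫ x, Y x * Z x ∂μ) := by
  have hi (a b c : ℝ) : Integrable (fun x => (X x + a * Y x + b * Z x + c * W x) ^ 4) μ :=
    IsGaussian.integrable_dual_pow_four μ (X + a • Y + b • Z + c • W)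
  have h2 (L₁ L₂ : StrongDual ℝ E) (c : ℝ) : Integrable (fun x => c * (L₁ x * L₂ x)) μ :=
    (IsGaussian.integrable_dual_mul μ L₁ L₂).const_mul c
  have hv (a b c : ℝ) : ∫ x, (X x + a * Y x + b * Z x + c * W x) ^ 2 ∂μ =
      1 * (∫ x, X x * X x ∂μ) + a ^ 2 * (∫ x, Y x * Y x ∂μ) + b ^ 2 * (∫ x, Z x * Z x ∂μ)
      + c ^ 2 * (∫ x, W x * W x ∂μ) + 2 * a * (∫ x, X x * Y x ∂μ) + 2 * b * (∫ x, X x * Z x ∂μ)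
      + 2 * c * (∫ x, X x * W x ∂μ) + 2 * a * b * (∫ x, Y x * Z x ∂μ)
      + 2 * a * c * (∫ x, Y x * W x ∂μ) + 2 * b * c * (∫ x, Z x * W x ∂μ) := by
    simp_rw [← integral_const_mul]
    rw [← integral_add, ← integral_add, ← integral_add, ← integral_add, ← integral_add,
      ← integral_add, ← integral_add, ← integral_add, ← integral_add]
    · exact integral_congr_ae (Filter.Eventually.of_forall fun x => by ring)
    all_goals first | exact h2 _ _ _ | skip
    all_goals repeat (first | exact h2 _ _ _ | refine Integrable.add ?_ (h2 _ _ _))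
  have h4 (a b c : ℝ) : ∫ x, (X x + a * Y x + b * Z x + c * W x) ^ 4 ∂μ =
      3 * (∫ x, (X x + a * Y x + b * Z x + c * W x) ^ 2 ∂μ) ^ 2 :=
    IsGaussian.integral_dual_pow_four μ (X + a • Y + b • Z + c • W) (h0 _)
  simp_rw [mul_four_eq_polarization]
  rw [integral_const_mul, integral_sub _ (hi _ _ _), integral_add _ (hi _ _ _),
    integral_add _ (hi _ _ _), integral_sub _ (hi _ _ _), integral_add _ (hi _ _ _),
    integral_sub _ (hi _ _ _), integral_sub (hi _ _ _) (hi _ _ _)]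
  · simp_rw [h4, hv]
    ring
  all_goals repeat (first | exact hi _ _ _ | refine Integrable.add ?_ (hi _ _ _)
                          | refine Integrable.sub ?_ (hi _ _ _))

end Isserlis

/-- Integration against the density `gaussDensity d S` is integration against the centered Gaussian
measure with covariance `2 S`. -/
theorem integral_mul_gaussDensity {d : ℕ} {S : Matrix (Fin d) (Fin d) ℝ} (hS : S.PosDef)
    {f : (Fin d → ℝ) → ℝ} (hf : Continuous f) :
    ∫ ξ, f ξ * gaussDensity d S ξ =
      ∫ x, f x.ofLp ∂(multivariateGaussian 0 ((2 : ℝ) • S)) := by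
  have h2S : ((2 : ℝ) • S).PosDef := hS.smul two_pos
  set C := CFC.sqrt ((2 : ℝ) • S) with hC
  have hCC : C * C = (2 : ℝ) • S := CFC.sqrt_mul_sqrt_self _ h2S.posSemidef.nonneg
  have hCt : Cᵀ = C := by
    have h : C.PosSemidef := Matrix.nonneg_iff_posSemidef.mp (CFC.sqrt_nonneg _)
    simpa using h.isHermitian.eq
  have hdet2 : C.det * C.det = 2 ^ d * S.det := by
    rw [← det_mul, hCC, det_smul, Fintype.card_fin]
  have hdet : C.det ≠ 0 := fun h => by
    have := hS.det_pos
    rw [h, zero_mul] at hdet2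
    exact absurd hdet2.symm (by positivity)
  have hCSC : C * S⁻¹ * C = (2 : ℝ) • 1 := by
    have hu : IsUnit C.det := hdet.isUnit
    have hS' : S = (1 / 2 : ℝ) • (C * C) := by rw [hCC, smul_smul]; norm_num
    have hinv : S⁻¹ = (2 : ℝ) • (C⁻¹ * C⁻¹) := by
      refine Matrix.inv_eq_right_inv ?_
      rw [hS', Matrix.smul_mul, Matrix.mul_smul, smul_smul, Matrix.mul_assoc,
        Matrix.mul_nonsing_inv_cancel_left _ _ hu, Matrix.mul_nonsing_inv _ hu]
      norm_num
    rw [hinv, Matrix.mul_smul, Matrix.smul_mul, Matrix.mul_nonsing_inv_cancel_left _ _ hu,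
      Matrix.nonsing_inv_mul _ hu]
  have hquad (y : Fin d → ℝ) :
      ∑ i, ∑ j, (C *ᵥ y) i * S⁻¹ i j * (C *ᵥ y) j = 2 * ∑ i, y i ^ 2 := by
    calc ∑ i, ∑ j, (C *ᵥ y) i * S⁻¹ i j * (C *ᵥ y) j
        = (C *ᵥ y) ⬝ᵥ (S⁻¹ *ᵥ (C *ᵥ y)) := by
          simp only [dotProduct, mulVec, Finset.mul_sum, mul_assoc]
      _ = y ⬝ᵥ ((C * S⁻¹ * C) *ᵥ y) := by
          rw [← mulVec_mulVec, ← mulVec_mulVec, dotProduct_mulVec y C, ← mulVec_transpose, hCt]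
      _ = 2 * ∑ i, y i ^ 2 := by
          rw [hCSC, smul_mulVec, one_mulVec, dotProduct_smul, smul_eq_mul]
          simp only [dotProduct, pow_two]
  have hpdf (y : Fin d → ℝ) : ∏ i, gaussianPDFReal 0 1 (y i) =
      (√(2 * π))⁻¹ ^ d * rexp (-(1 / 4) * ∑ i, ∑ j, (C *ᵥ y) i * S⁻¹ i j * (C *ᵥ y) j) := by
    rw [hquad]
    simp only [gaussianPDFReal, Finset.prod_mul_distrib, ← Real.exp_sum]
    simp only [NNReal.coe_one, mul_one, Finset.prod_const, Finset.card_univ, Fintype.card_fin,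
      sub_zero, Finset.mul_sum]
    congr 2
    exact Finset.sum_congr rfl fun i _ => by ring
  have hconst : |C.det|⁻¹ * (√(2 * π))⁻¹ ^ d = (√((4 * π) ^ d * S.det))⁻¹ := by
    have h := hS.det_pos
    rw [inv_pow, ← mul_inv, eq_comm, _root_.inv_inj,
      Real.sqrt_eq_iff_mul_self_eq (by positivity) (by positivity), mul_mul_mul_comm,
      abs_mul_abs_self, hdet2, ← mul_pow, Real.mul_self_sqrt (by positivity), mul_right_comm,
      ← mul_pow]
    ring_nf
  have hg : Continuous fun ξ : Fin d → ℝ =>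
      (√(2 * π))⁻¹ ^ d * rexp (-(1 / 4) * ∑ i, ∑ j, ξ i * S⁻¹ i j * ξ j) * f ξ := by fun_prop
  have hmap := Real.map_matrix_volume_pi_eq_smul_volume_pi hdet
  symm
  calc ∫ x, f x.ofLp ∂(multivariateGaussian 0 ((2 : ℝ) • S))
      = ∫ y : Fin d → ℝ, f (C *ᵥ y) ∂(Measure.pi fun _ => gaussianReal 0 1) := by
        rw [multivariateGaussian, integral_map (by fun_prop)
          (by fun_prop), ← map_pi_eq_stdGaussian, integral_map (by fun_prop) (by fun_prop)]
        simp [hC]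
    _ = ∫ y : Fin d → ℝ, (∏ i, gaussianPDFReal 0 1 (y i)) * f (C *ᵥ y) := by
        rw [pi_gaussianReal_eq_withDensity, integral_withDensity_eq_integral_toReal_smul
          (by fun_prop) (Filter.Eventually.of_forall fun _ => ENNReal.ofReal_lt_top)]
        refine integral_congr_ae (Filter.Eventually.of_forall fun y => ?_)
        simp only [smul_eq_mul]
        rw [ENNReal.toReal_ofReal
          (Finset.prod_nonneg fun i _ => gaussianPDFReal_nonneg 0 1 (y i))]
    _ = ∫ ξ, (√(2 * π))⁻¹ ^ d * rexp (-(1 / 4) * ∑ i, ∑ j, ξ i * S⁻¹ i j * ξ j) * f ξ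
          ∂(Measure.map (toLin' C) volume) := by
        rw [integral_map (LinearMap.continuous_on_pi _).aemeasurable hg.aestronglyMeasurable]
        simp only [hpdf, toLin'_apply]
    _ = ∫ ξ, f ξ * gaussDensity d S ξ := by
        rw [hmap, integral_smul_measure, ENNReal.toReal_ofReal (abs_nonneg _), smul_eq_mul,
          ← integral_const_mul, abs_inv]
        refine integral_congr_ae (Filter.Eventually.of_forall fun ξ => ?_)
        simp only [gaussDensity, ← hconst]
        ring

section Moments

variable {ι : Type*} [Fintype ι] [DecidableEq ι] {S : Matrix ι ι ℝ}

theorem integrable_mul_multivariateGaussian (i j : ι) :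
    Integrable (fun x => x i * x j) (multivariateGaussian 0 S) :=
  IsGaussian.integrable_dual_mul _ (EuclideanSpace.proj i) (EuclideanSpace.proj j)

theorem integrable_mul_four_multivariateGaussian (i j k l : ι) :
    Integrable (fun x => x i * x j * x k * x l) (multivariateGaussian 0 S) :=
  IsGaussian.integrable_dual_mul_four _ (EuclideanSpace.proj i) (EuclideanSpace.proj j)
    (EuclideanSpace.proj k) (EuclideanSpace.proj l)

theorem integral_dual_multivariateGaussian (L : StrongDual ℝ (EuclideanSpace ℝ ι)) :
    ∫ x, L x ∂(multivariateGaussian 0 S) = 0 := by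
  rw [ContinuousLinearMap.integral_comp_id_comm IsGaussian.integrable_id L]
  simp

theorem integral_mul_multivariateGaussian (hS : S.PosSemidef) (i j : ι) :
    ∫ x, x i * x j ∂(multivariateGaussian 0 S) = S i j := by
  have h (i : ι) : ∫ x, x i ∂(multivariateGaussian 0 S) = 0 :=
    integral_dual_multivariateGaussian (EuclideanSpace.proj i)
  rw [← covariance_eval_multivariateGaussian (μ := 0) hS i j, covariance]
  simp only [h, sub_zero]

theorem integral_mul_four_multivariateGaussian (hS : S.PosSemidef) (i j k l : ι) :
    ∫ x, x i * x j * x k * x l ∂(multivariateGaussian 0 S) =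
      S i j * S k l + S i k * S j l + S i l * S j k := by
  simp only [← integral_mul_multivariateGaussian hS]
  exact IsGaussian.integral_dual_mul_four _ integral_dual_multivariateGaussian
    (EuclideanSpace.proj i) (EuclideanSpace.proj j) (EuclideanSpace.proj k) (EuclideanSpace.proj l)

theorem integral_quadratic_multivariateGaussian (hS : S.PosSemidef) (c : ι → ι → ℝ) :
    ∫ x, ∑ i, ∑ j, c i j * x i * x j ∂(multivariateGaussian 0 S) = ∑ i, ∑ j, c i j * S i j := by
  have h (i j : ι) := (integrable_mul_multivariateGaussian (S := S) i j).const_mul (c i j)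
  simp only [mul_assoc]
  rw [integral_finsetSum _ fun i _ => integrable_finsetSum _ fun j _ => h i j]
  refine Finset.sum_congr rfl fun i _ => ?_
  rw [integral_finsetSum _ fun j _ => h i j]
  simp only [integral_const_mul, integral_mul_multivariateGaussian hS]

theorem integrable_quadratic_multivariateGaussian (c : ι → ι → ℝ) :
    Integrable (fun x => ∑ i, ∑ j, c i j * x i * x j) (multivariateGaussian 0 S) := by
  simp only [mul_assoc]
  exact integrable_finsetSum _ fun i _ => integrable_finsetSum _ fun j _ =>
    (integrable_mul_multivariateGaussian i j).const_mul _

theorem integrable_quartic_multivariateGaussian (c : ι → ι → ι → ι → ℝ) :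
    Integrable (fun x => ∑ i, ∑ j, ∑ k, ∑ l, c i j k l * x i * x j * x k * x l)
      (multivariateGaussian 0 S) := by
  refine integrable_finsetSum _ fun i _ => integrable_finsetSum _ fun j _ =>
    integrable_finsetSum _ fun k _ => integrable_finsetSum _ fun l _ => ?_
  simpa only [mul_assoc] using
    (integrable_mul_four_multivariateGaussian (S := S) i j k l).const_mul (c i j k l)

theorem integral_quartic_multivariateGaussian (hS : S.PosSemidef) (c : ι → ι → ι → ι → ℝ) :
    ∫ x, ∑ i, ∑ j, ∑ k, ∑ l, c i j k l * x i * x j * x k * x l ∂(multivariateGaussian 0 S) =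
      ∑ i, ∑ j, ∑ k, ∑ l, c i j k l * (S i j * S k l + S i k * S j l + S i l * S j k) := by
  have h (i j k l : ι) : Integrable (fun x => c i j k l * x i * x j * x k * x l)
      (multivariateGaussian 0 S) := by
    simpa only [mul_assoc] using
      (integrable_mul_four_multivariateGaussian (S := S) i j k l).const_mul (c i j k l)
  rw [integral_finsetSum _ fun i _ => integrable_finsetSum _ fun j _ =>
    integrable_finsetSum _ fun k _ => integrable_finsetSum _ fun l _ => h i j k l]
  refine Finset.sum_congr rfl fun i _ => ?_
  rw [integral_finsetSum _ fun j _ =>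
    integrable_finsetSum _ fun k _ => integrable_finsetSum _ fun l _ => h i j k l]
  refine Finset.sum_congr rfl fun j _ => ?_
  rw [integral_finsetSum _ fun k _ => integrable_finsetSum _ fun l _ => h i j k l]
  refine Finset.sum_congr rfl fun k _ => ?_
  rw [integral_finsetSum _ fun l _ => h i j k l]
  refine Finset.sum_congr rfl fun l _ => ?_
  rw [← integral_mul_four_multivariateGaussian hS, ← integral_const_mul]
  simp only [mul_assoc]

theorem integral_quartic_add_quadratic_multivariateGaussian (hS : S.PosSemidef) (r s t : ℝ)
    (p : ι → ι → ι → ι → ℝ) (q u : ι → ι → ℝ) :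
    ∫ x, r * (∑ i, ∑ j, ∑ k, ∑ l, p i j k l * x i * x j * x k * x l)
        + s * (∑ i, ∑ j, q i j * x i * x j) + t * (∑ i, ∑ j, u i j * x i * x j)
        ∂(multivariateGaussian 0 S) =
      r * (∑ i, ∑ j, ∑ k, ∑ l, p i j k l * (S i j * S k l + S i k * S j l + S i l * S j k))
        + s * (∑ i, ∑ j, q i j * S i j) + t * (∑ i, ∑ j, u i j * S i j) := by
  have hp := (integrable_quartic_multivariateGaussian (S := S) p).const_mul r
  have hq := (integrable_quadratic_multivariateGaussian (S := S) q).const_mul s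
  have hu := (integrable_quadratic_multivariateGaussian (S := S) u).const_mul t
  have h := integral_add (hp.add hq) hu
  simp only [Pi.add_apply] at h
  rw [h, integral_add hp hq, integral_const_mul, integral_const_mul,
    integral_const_mul, integral_quartic_multivariateGaussian hS,
    integral_quadratic_multivariateGaussian hS, integral_quadratic_multivariateGaussian hS]

end Moments

section Contraction

variable {ι : Type*} [Fintype ι]

theorem sum_conj_eq (P M Q : Matrix ι ι ℝ) (l m : ι) :
    ∑ a, ∑ b, P l a * M a b * Q b m = (P * M * Q) l m := by
  simp only [Matrix.mul_apply, Finset.sum_mul]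
  exact Finset.sum_comm

theorem trace_mul_eq_sum (P M : Matrix ι ι ℝ) : (P * M).trace = ∑ a, ∑ b, P a b * M b a := by
  simp only [Matrix.trace, Matrix.diag_apply, Matrix.mul_apply]

/-- Contracting the conjugate `S⁻¹ M S⁻¹` of a symmetric `M` with the fourth Gaussian moments. -/
theorem sum_conj_mul_moment_four [DecidableEq ι] {S : Matrix ι ι ℝ}
    (hS : IsUnit S.det) (hSt : Sᵀ = S) {M : Matrix ι ι ℝ} (hM : Mᵀ = M) (i j : ι) :
    ∑ l, ∑ m, (∑ a, ∑ b, S⁻¹ l a * M a b * S⁻¹ b m) *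
      (S i j * S l m + S i l * S j m + S i m * S j l) =
      S i j * (∑ a, ∑ b, S⁻¹ a b * M b a) + 2 * M i j := by
  have hsym (a b : ι) : S a b = S b a := congrFun (congrFun hSt b) a
  have hMsym (a b : ι) : M a b = M b a := congrFun (congrFun hM b) a
  have hSMS : S * (S⁻¹ * M * S⁻¹) * S = M := by
    rw [Matrix.mul_assoc, Matrix.nonsing_inv_mul_cancel_right _ _ hS,
      Matrix.mul_nonsing_inv_cancel_left _ _ hS]
  have h1 : ∑ l, ∑ m, (S⁻¹ * M * S⁻¹) l m * S l m = ∑ a, ∑ b, S⁻¹ a b * M b a := by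
    conv_rhs =>
      rw [← trace_mul_eq_sum, ← Matrix.nonsing_inv_mul_cancel_right S (S⁻¹ * M) hS,
        trace_mul_eq_sum]
    exact Finset.sum_congr rfl fun l _ => Finset.sum_congr rfl fun m _ => by rw [hsym l m]
  have h2 (i j : ι) : ∑ l, ∑ m, (S⁻¹ * M * S⁻¹) l m * (S i l * S j m) = M i j := by
    conv_rhs => rw [← hSMS, ← sum_conj_eq]
    exact Finset.sum_congr rfl fun l _ => Finset.sum_congr rfl fun m _ => by
      rw [hsym j m]; ring
  calc _ = S i j * (∑ l, ∑ m, (S⁻¹ * M * S⁻¹) l m * S l m)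
        + ∑ l, ∑ m, (S⁻¹ * M * S⁻¹) l m * (S i l * S j m)
        + ∑ l, ∑ m, (S⁻¹ * M * S⁻¹) l m * (S j l * S i m) := by
        simp only [Finset.mul_sum, ← Finset.sum_add_distrib, sum_conj_eq]
        exact Finset.sum_congr rfl fun l _ => Finset.sum_congr rfl fun m _ => by ring
    _ = _ := by
        rw [h1, h2, h2, hMsym j i]
        ring

end Contraction

theorem pd2_congr {d : ℕ} {f g : (Fin d → ℝ) → ℝ} {x : Fin d → ℝ} (h : f =ᶠ[nhds x] g)
    (i j : Fin d) : pd2 f i j x = pd2 g i j x := by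
  have h' : (fun y => pd f j y) =ᶠ[nhds x] fun y => pd g j y := by
    filter_upwards [h.eventually_nhds] with y hy
    simp only [pd, Filter.EventuallyEq.fderiv_eq hy]
  exact congrArg (fun L : (Fin d → ℝ) →L[ℝ] ℝ => L (Pi.single i 1)) h'.fderiv_eq

theorem continuous_A13 (d : ℕ) (α : ℝ) (D : (Fin d → ℝ) → Matrix (Fin d) (Fin d) ℝ)
    (x₀ : Fin d → ℝ) : Continuous (A13 d α D x₀) := by
  unfold A13
  fun_prop

/-- `⟨𝒜^{1,3}(ξ)⟩₀ = α² ∂_i ∂_j D^{ij}` (double divergence of `D` at `x₀`). -/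
theorem A13_mean (d : ℕ) (hd : 1 ≤ d)
    (U : Set (Fin d → ℝ)) (hU : IsOpen U) (x₀ : Fin d → ℝ) (hx₀ : x₀ ∈ U)
    (α : ℝ)
    (D : (Fin d → ℝ) → Matrix (Fin d) (Fin d) ℝ)
    (hsymm : ∀ x ∈ U, (D x).IsSymm) (hpos : ∀ x ∈ U, (D x).PosDef)
    (hC2 : ∀ i j, ContDiffOn ℝ 2 (fun x => D x i j) U) :
    (∫ ξ : Fin d → ℝ, A13 d α D x₀ ξ * gaussDensity d (D x₀) ξ) =
      α^2 * ∑ i, ∑ j, pd2 (fun x => D x i j) i j x₀ := by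
  have hpd := hpos x₀ hx₀
  have hdet : IsUnit (D x₀).det := hpd.det_pos.ne'.isUnit
  have hcov : ((2 : ℝ) • D x₀).PosSemidef := (hpd.smul two_pos).posSemidef
  have hsym (i j a b : Fin d) : pd2 (fun x => D x a b) i j x₀ = pd2 (fun x => D x b a) i j x₀ := by
    refine pd2_congr ?_ i j
    filter_upwards [hU.mem_nhds hx₀] with x hx using (hsymm x hx).apply b a
  rw [integral_mul_gaussDensity hpd (continuous_A13 d α D x₀)]
  refine (integral_quartic_add_quadratic_multivariateGaussian hcov _ _ _ _ _ _).trans ?_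
  have hquartic (i j : Fin d) : ∑ l, ∑ m,
      (∑ a, ∑ b, (D x₀)⁻¹ l a * pd2 (fun x => D x a b) i j x₀ * (D x₀)⁻¹ b m) *
        (((2 : ℝ) • D x₀) i j * ((2 : ℝ) • D x₀) l m + ((2 : ℝ) • D x₀) i l * ((2 : ℝ) • D x₀) j m
          + ((2 : ℝ) • D x₀) i m * ((2 : ℝ) • D x₀) j l) =
      4 * (D x₀ i j * (∑ a, ∑ b, (D x₀)⁻¹ a b * pd2 (fun x => D x b a) i j x₀))
        + 8 * pd2 (fun x => D x i j) i j x₀ := by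
    have h := sum_conj_mul_moment_four hdet (hsymm x₀ hx₀)
      (M := Matrix.of fun a b => pd2 (fun x => D x a b) i j x₀)
      (by ext a b; exact hsym i j b a) i j
    simp only [Matrix.of_apply] at h
    calc _ = 4 * (D x₀ i j * (∑ a, ∑ b, (D x₀)⁻¹ a b * pd2 (fun x => D x b a) i j x₀)
          + 2 * pd2 (fun x => D x i j) i j x₀) := by
          rw [← h, Finset.mul_sum]
          refine Finset.sum_congr rfl fun l _ => ?_
          rw [Finset.mul_sum]
          refine Finset.sum_congr rfl fun m _ => ?_
          simp only [Matrix.smul_apply, smul_eq_mul]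
          ring
      _ = _ := by ring
  have hdiv : ∑ j, ∑ l, (∑ i, ∑ k, (D x₀)⁻¹ i j * pd2 (fun x => D x i k) k l x₀) *
      ((2 : ℝ) • D x₀) j l = 2 * ∑ i, ∑ j, pd2 (fun x => D x i j) i j x₀ := by
    have hinv (i l : Fin d) : ∑ j, (D x₀)⁻¹ i j * D x₀ j l = if i = l then 1 else 0 := by
      rw [← Matrix.mul_apply, Matrix.nonsing_inv_mul _ hdet, Matrix.one_apply]
    calc _ = 2 * ∑ l, ∑ i, ∑ k, (∑ j, (D x₀)⁻¹ i j * D x₀ j l) *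
          pd2 (fun x => D x i k) k l x₀ := by
          rw [Finset.sum_comm]
          simp only [Matrix.smul_apply, smul_eq_mul, Finset.mul_sum, Finset.sum_mul]
          refine Finset.sum_congr rfl fun l _ => ?_
          rw [Finset.sum_comm]
          refine Finset.sum_congr rfl fun i _ => ?_
          rw [Finset.sum_comm]
          exact Finset.sum_congr rfl fun k _ => Finset.sum_congr rfl fun j _ => by ring
      _ = 2 * ∑ l, ∑ k, pd2 (fun x => D x l k) k l x₀ := by
          simp only [hinv, ite_mul, one_mul, zero_mul, Finset.sum_ite_irrel, Finset.sum_const_zero,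
            Finset.sum_ite_eq', Finset.mem_univ, if_true]
      _ = _ := by
          rw [Finset.sum_comm]
          simp only [fun l k => hsym k l l k]
  rw [hdiv]
  simp only [hquartic, Finset.sum_add_distrib, ← Finset.mul_sum]
  simp only [Matrix.smul_apply, smul_eq_mul]
  have htrace : ∑ i, ∑ j, (∑ a, ∑ b, (D x₀)⁻¹ a b * pd2 (fun x => D x b a) i j x₀) *
      (2 * D x₀ i j) = 2 * ∑ i, ∑ j,
        D x₀ i j * (∑ a, ∑ b, (D x₀)⁻¹ a b * pd2 (fun x => D x b a) i j x₀) := by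
    rw [Finset.mul_sum]
    refine Finset.sum_congr rfl fun i _ => ?_
    rw [Finset.mul_sum]
    exact Finset.sum_congr rfl fun j _ => by ring
  rw [htrace]
  ring
end

section
/- The Gaussian expectation ½ ⟨(𝒜^{1/2}(ξ))²⟩₀ equals α² [ ½ (∂_m D^{jk}) D⁻¹_{kl} (∂_n D^{lr}) D⁻¹_{rj} D^{mn} + (∂_m D^{sk}) D⁻¹_{kl} (∂_s D^{lm}) ], all quantities evaluated at x₀. -/
open MeasureTheory Real

/-- The polynomial `𝒜^{1/2}(ξ) = −(α/4)(D⁻¹(∂_k D)D⁻¹)_{ij} ξ^i ξ^j ξ^k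
    + (α/2) tr(D⁻¹ ∂_i D) ξ^i + α D⁻¹_{ij}(∂_l D^{jl}) ξ^i`,
    all fields evaluated at `x₀`. -/
noncomputable def Ahalf (d : ℕ) (α : ℝ)
    (D : (Fin d → ℝ) → Matrix (Fin d) (Fin d) ℝ) (x₀ : Fin d → ℝ)
    (ξ : Fin d → ℝ) : ℝ :=
  -(α/4) * (∑ i, ∑ j, ∑ k,
      (∑ a, ∑ b, (D x₀)⁻¹ i a * pd (fun x => D x a b) k x₀ * (D x₀)⁻¹ b j) *
        ξ i * ξ j * ξ k)
  + (α/2) * (∑ i, (∑ a, ∑ b, (D x₀)⁻¹ a b * pd (fun x => D x b a) i x₀) * ξ i)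
  + α * (∑ i, (∑ j, ∑ l, (D x₀)⁻¹ i j * pd (fun x => D x j l) l x₀) * ξ i)

section GaussianMoments

open MvPolynomial

/-- The centred Gaussian density on `ℝ` of variance `2`. -/
noncomputable def heatWeight (x : ℝ) : ℝ :=
  (Real.sqrt (4 * π))⁻¹ * Real.exp (-(1/4) * x ^ 2)

theorem integrable_pow_mul_heatWeight (n : ℕ) :
    Integrable (fun x : ℝ => x ^ n * heatWeight x) := by
  have h := integrable_rpow_mul_exp_neg_mul_sq (b := 1/4) (by norm_num)
    (s := n) (by linarith [(Nat.cast_nonneg n : (0:ℝ) ≤ n)])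
  refine (h.const_mul (Real.sqrt (4 * π))⁻¹).congr (.of_forall fun x => ?_)
  simp only [heatWeight, Real.rpow_natCast]
  ring

theorem integral_heatWeight : ∫ x, heatWeight x = 1 := by
  simp only [heatWeight]
  rw [integral_const_mul, integral_gaussian, inv_mul_eq_one₀ (by positivity)]
  congr 1
  ring

theorem hasDerivAt_heatWeight (x : ℝ) :
    HasDerivAt heatWeight (-(1/2) * (x * heatWeight x)) x := by
  have h := (((hasDerivAt_pow 2 x).const_mul (-(1/4 : ℝ))).exp).const_mul (Real.sqrt (4 * π))⁻¹
  convert! h using 1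
  simp only [heatWeight]
  norm_num
  ring

theorem integral_pow_succ_mul_heatWeight (n : ℕ) :
    ∫ x, x ^ (n + 1) * heatWeight x = 2 * (n * ∫ x, x ^ (n - 1) * heatWeight x) := by
  have h := integral_mul_deriv_eq_deriv_mul_of_integrable
    (u := fun x : ℝ => x ^ n) (u' := fun x => n * x ^ (n - 1)) (v := heatWeight)
    (v' := fun x => -(1/2) * (x * heatWeight x))
    (fun x _ => hasDerivAt_pow n x) (fun x _ => hasDerivAt_heatWeight x)
    (((integrable_pow_mul_heatWeight (n + 1)).const_mul (-(1/2))).congr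
      (.of_forall fun x => by simp only [Pi.mul_apply]; ring))
    (((integrable_pow_mul_heatWeight (n - 1)).const_mul (n : ℝ)).congr
      (.of_forall fun x => by simp only [Pi.mul_apply]; ring))
    (integrable_pow_mul_heatWeight n)
  have h1 : ∀ x : ℝ, x ^ n * (-(1/2) * (x * heatWeight x)) =
      -(1/2) * (x ^ (n + 1) * heatWeight x) := fun x => by ring
  simp only [h1, mul_assoc, integral_const_mul] at h
  linarith

variable {ι : Type*} [Fintype ι]

theorem eval_monomial_mul_prod_heatWeight (s : ι →₀ ℕ) (c : ℝ) (z : ι → ℝ) :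
    eval z (monomial s c) * ∏ i, heatWeight (z i) =
      c * ∏ i, z i ^ s i * heatWeight (z i) := by
  rw [eval_monomial, Finsupp.prod_fintype _ _ (by simp), Finset.prod_mul_distrib, mul_assoc]

theorem integrable_eval_mul_prod_heatWeight (p : MvPolynomial ι ℝ) :
    Integrable (fun z : ι → ℝ => eval z p * ∏ i, heatWeight (z i)) := by
  induction p using MvPolynomial.induction_on' with
  | monomial s c =>
    simp only [eval_monomial_mul_prod_heatWeight]
    exact (Integrable.fintype_prod (f := fun i (x : ℝ) => x ^ s i * heatWeight x)
      fun i => integrable_pow_mul_heatWeight (s i)).const_mul c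
  | add p q hp hq =>
    simp only [map_add, add_mul]
    exact hp.add hq

/-- Expectation of a polynomial in independent centred Gaussian variables of variance `2`. -/
noncomputable def heatMean (ι : Type*) [Fintype ι] : MvPolynomial ι ℝ →ₗ[ℝ] ℝ where
  toFun p := ∫ z : ι → ℝ, eval z p * ∏ i, heatWeight (z i)
  map_add' p q := by
    simp only [map_add, add_mul]
    exact integral_add (integrable_eval_mul_prod_heatWeight p)
      (integrable_eval_mul_prod_heatWeight q)
  map_smul' c p := by
    simp only [smul_eval, mul_assoc, integral_const_mul, RingHom.id_apply, smul_eq_mul]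

theorem heatMean_monomial (s : ι →₀ ℕ) (c : ℝ) :
    heatMean ι (monomial s c) = c * ∏ i, ∫ x, x ^ s i * heatWeight x := by
  change ∫ z : ι → ℝ, eval z (monomial s c) * ∏ i, heatWeight (z i) = _
  simp only [eval_monomial_mul_prod_heatWeight, integral_const_mul]
  rw [integral_fintype_prod_volume_eq_prod (fun i (x : ℝ) => x ^ s i * heatWeight x)]

theorem heatMean_one : heatMean ι 1 = 1 := by
  rw [← C_1, ← monomial_zero', heatMean_monomial]
  simp [integral_heatWeight]

theorem heatMean_X_mul (i : ι) (p : MvPolynomial ι ℝ) :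
    heatMean ι (X i * p) = 2 * heatMean ι (pderiv i p) := by
  classical
  induction p using MvPolynomial.induction_on' with
  | monomial s c =>
    rw [X, monomial_mul, pderiv_monomial, heatMean_monomial, heatMean_monomial,
      ← Finset.mul_prod_erase _ _ (Finset.mem_univ i),
      ← Finset.mul_prod_erase _ (fun j => ∫ x, x ^ (s - Finsupp.single i 1 : ι →₀ ℕ) j * heatWeight x)
        (Finset.mem_univ i)]
    have h : ∀ j ∈ Finset.univ.erase i,
        (∫ x, x ^ (Finsupp.single i 1 + s : ι →₀ ℕ) j * heatWeight x) =
          ∫ x, x ^ (s - Finsupp.single i 1 : ι →₀ ℕ) j * heatWeight x := fun j hj => by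
      simp [Finsupp.single_eq_of_ne (Finset.ne_of_mem_erase hj)]
    rw [Finset.prod_congr rfl h]
    have h' := integral_pow_succ_mul_heatWeight (s i)
    simp only [Finsupp.add_apply, Finsupp.single_eq_same, Finsupp.tsub_apply, add_comm 1]
    rw [h']
    ring
  | add p q hp hq => rw [mul_add, map_add, hp, hq, map_add, map_add, mul_add]

/-- The substitution of the linear forms given by the rows of a matrix. -/
noncomputable def linSubst (B : Matrix ι ι ℝ) : MvPolynomial ι ℝ →ₐ[ℝ] MvPolynomial ι ℝ :=
  bind₁ fun i => ∑ a, C (B i a) * X a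

theorem eval_linSubst (B : Matrix ι ι ℝ) (p : MvPolynomial ι ℝ) (z : ι → ℝ) :
    eval z (linSubst B p) = eval (B.mulVec z) p := by
  rw [linSubst, eval, eval₂Hom_bind₁]
  congr 2
  ext i
  simp [Matrix.mulVec, dotProduct]

theorem pderiv_linSubst (B : Matrix ι ι ℝ) (a : ι) (p : MvPolynomial ι ℝ) :
    pderiv a (linSubst B p) = ∑ j, C (B j a) * linSubst B (pderiv j p) := by
  classical
  induction p using MvPolynomial.induction_on with
  | C c => simp [linSubst]
  | add p q hp hq => simp only [map_add, hp, hq, mul_add, Finset.sum_add_distrib]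
  | mul_X p i hp =>
    have h : pderiv a (linSubst B (X i)) = C (B i a) := by
      simp [linSubst, pderiv_X, Pi.single_apply]
    rw [map_mul, pderiv_mul, hp, h]
    simp only [pderiv_mul, pderiv_X, map_add, map_mul, mul_add, Finset.sum_add_distrib,
      Finset.sum_mul]
    congr 1
    · exact Finset.sum_congr rfl fun j _ => by ring
    · simp [Pi.single_apply, mul_comm]

/-- Gaussian integration by parts for the covariance `2 B Bᵀ`. -/
theorem heatMean_linSubst_X_mul (B : Matrix ι ι ℝ) (i : ι) (p : MvPolynomial ι ℝ) :
    heatMean ι (linSubst B (X i * p)) =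
      ∑ j, 2 * (B * B.transpose) i j * heatMean ι (linSubst B (pderiv j p)) := by
  have h : linSubst B (X i) = ∑ a, B i a • X a := by
    simp [linSubst, smul_eq_C_mul]
  simp only [map_mul, h, Finset.sum_mul, smul_mul_assoc, map_sum, map_smul, heatMean_X_mul,
    pderiv_linSubst, ← smul_eq_C_mul, smul_eq_mul, Matrix.mul_apply, Matrix.transpose_apply,
    Finset.mul_sum, Finset.sum_mul]
  rw [Finset.sum_comm]
  exact Finset.sum_congr rfl fun j _ => Finset.sum_congr rfl fun a _ => by ring

end GaussianMoments

open scoped MatrixOrder Matrix.Norms.L2Operator in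
theorem Matrix.PosDef.exists_eq_mul_transpose {n : Type*} [Fintype n] [DecidableEq n] {S : Matrix n n ℝ}
    (hS : S.PosDef) : ∃ B : Matrix n n ℝ, S = B * B.transpose := by
  obtain ⟨B, rfl⟩ := CStarAlgebra.nonneg_iff_eq_star_mul_self.mp hS.posSemidef.nonneg
  exact ⟨B.transpose, by rw [Matrix.transpose_transpose]; rfl⟩

theorem gaussDensity_mulVec {d : ℕ} (B : Matrix (Fin d) (Fin d) ℝ) (hB : B.det ≠ 0)
    (z : Fin d → ℝ) :
    |B.det| * gaussDensity d (B * B.transpose) (B.mulVec z) = ∏ i, heatWeight (z i) := by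
  have hq : ∑ i, ∑ j, B.mulVec z i * (B * B.transpose)⁻¹ i j * B.mulVec z j = ∑ i, z i ^ 2 := by
    have hu : IsUnit B.det := hB.isUnit
    have h : dotProduct (B.mulVec z) ((B * B.transpose)⁻¹.mulVec (B.mulVec z)) =
        dotProduct z z := by
      rw [Matrix.mul_inv_rev, Matrix.mulVec_mulVec, Matrix.mul_assoc, Matrix.nonsing_inv_mul _ hu,
        Matrix.mul_one, Matrix.dotProduct_mulVec, ← Matrix.transpose_nonsing_inv,
        Matrix.vecMul_transpose, Matrix.mulVec_mulVec, Matrix.nonsing_inv_mul _ hu,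
        Matrix.one_mulVec]
    simpa [dotProduct, Matrix.mulVec, Finset.mul_sum, mul_assoc, sq] using h
  have hs : Real.sqrt ((4 * π) ^ d * (B * B.transpose).det) =
      Real.sqrt (4 * π) ^ d * |B.det| := by
    rw [Matrix.det_mul, Matrix.det_transpose, Real.sqrt_mul (by positivity),
      Real.sqrt_mul_self_eq_abs]
    congr 1
    rw [Real.sqrt_eq_iff_mul_self_eq (by positivity) (by positivity), ← mul_pow,
      Real.mul_self_sqrt (by positivity)]
  simp only [gaussDensity, heatWeight, hq, hs, Finset.prod_mul_distrib, Finset.prod_const,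
    Finset.card_univ, Fintype.card_fin, ← Real.exp_sum, ← Finset.mul_sum]
  have := abs_ne_zero.2 hB
  rw [inv_pow, mul_inv]
  field_simp

theorem integral_eval_mul_gaussDensity {d : ℕ} (B : Matrix (Fin d) (Fin d) ℝ) (hB : B.det ≠ 0)
    (p : MvPolynomial (Fin d) ℝ) :
    ∫ ξ, MvPolynomial.eval ξ p * gaussDensity d (B * B.transpose) ξ =
      heatMean (Fin d) (linSubst B p) := by
  have hm := Real.map_matrix_volume_pi_eq_smul_volume_pi hB
  have h : ∫ ξ, MvPolynomial.eval ξ p * gaussDensity d (B * B.transpose) ξ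
      ∂(Measure.map (Matrix.toLin' B) volume) =
      ∫ z, MvPolynomial.eval (B.mulVec z) p * gaussDensity d (B * B.transpose) (B.mulVec z) := by
    refine integral_map (by fun_prop) (Continuous.aestronglyMeasurable ?_)
    have hp := MvPolynomial.continuous_eval p
    unfold gaussDensity
    fun_prop
  rw [hm, integral_smul_measure, ENNReal.toReal_ofReal (abs_nonneg _), abs_inv, smul_eq_mul,
    inv_mul_eq_iff_eq_mul₀ (abs_ne_zero.2 hB), ← integral_const_mul] at h
  rw [h]
  refine integral_congr_ae (.of_forall fun z => ?_)
  simp only [eval_linSubst, ← gaussDensity_mulVec B hB]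
  ring

section CubicForms

open MvPolynomial

variable {ι : Type*}

/-- The derivation sending the variable `X j` to the constant `K i j`. -/
noncomputable def covDeriv (K : Matrix ι ι ℝ) (i : ι) :
    Derivation ℝ (MvPolynomial ι ℝ) (MvPolynomial ι ℝ) :=
  mkDerivation ℝ fun j => C (K i j)

theorem covDeriv_X (K : Matrix ι ι ℝ) (i j : ι) : covDeriv K i (X j) = C (K i j) :=
  mkDerivation_X _ _ _

/-- The Wick product of three centred Gaussian variables with covariance `K`. -/
noncomputable def wickCubic (K : Matrix ι ι ℝ) (i j k : ι) : MvPolynomial ι ℝ :=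
  X i * (X j * X k) - K i j • X k - K i k • X j - K j k • X i

theorem map_wickCubic_mul {K : Matrix ι ι ℝ} {L : MvPolynomial ι ℝ →ₗ[ℝ] ℝ}
    (hL : ∀ i p, L (X i * p) = L (covDeriv K i p)) (i j k : ι) (p : MvPolynomial ι ℝ) :
    L (wickCubic K i j k * p) = L (covDeriv K k (covDeriv K j (covDeriv K i p))) := by
  have h : wickCubic K i j k * p =
      X i * (X j * (X k * p)) - K i j • (X k * p) - K i k • (X j * p) - K j k • (X i * p) := by
    simp only [wickCubic, smul_eq_C_mul]
    ring
  have h₁ : covDeriv K i (X j * (X k * p)) =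
      X j * (X k * covDeriv K i p) + K i k • (X j * p) + K i j • (X k * p) := by
    simp only [Derivation.leibniz, covDeriv_X, smul_eq_C_mul, smul_eq_mul]
    ring
  have h₂ : covDeriv K j (X k * covDeriv K i p) =
      X k * covDeriv K j (covDeriv K i p) + K j k • covDeriv K i p := by
    simp only [Derivation.leibniz, covDeriv_X, smul_eq_C_mul, smul_eq_mul]
    ring
  simp only [h, map_sub, map_add, map_smul, hL i (X j * (X k * p)), h₁,
    hL j (X k * covDeriv K i p), h₂, hL k (covDeriv K j (covDeriv K i p)), hL i p, smul_eq_mul]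
  ring

theorem covDeriv_wickCubic (K : Matrix ι ι ℝ) (i j k l m n : ι) :
    covDeriv K k (covDeriv K j (covDeriv K i (wickCubic K l m n))) =
      C (K i l * K j m * K k n + K j l * K i m * K k n + K i l * K k m * K j n +
        K k l * K i m * K j n + K j l * K k m * K i n + K k l * K j m * K i n) := by
  simp only [wickCubic, map_add, map_sub, map_mul, Derivation.leibniz, covDeriv_X, derivation_C,
    map_zero, smul_eq_C_mul, smul_eq_mul]
  ring

variable [Fintype ι]

theorem covDeriv_eq_sum_pderiv (K : Matrix ι ι ℝ) (i : ι) (p : MvPolynomial ι ℝ) :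
    covDeriv K i p = ∑ j, K i j • pderiv j p := by
  classical
  induction p using MvPolynomial.induction_on with
  | C c => simp [derivation_C]
  | add p q hp hq => simp only [map_add, hp, hq, smul_add, Finset.sum_add_distrib]
  | mul_X p k hp =>
    simp only [Derivation.leibniz, hp, covDeriv_X, pderiv_X, Pi.single_apply, smul_eq_mul,
      smul_eq_C_mul, mul_add, Finset.sum_add_distrib, Finset.mul_sum]
    congr 1
    · simp [mul_comm]
    · exact Finset.sum_congr rfl fun j _ => by ring

/-- The coefficients of a cubic form with all three indices raised by `K`. -/
def raise (K : Matrix ι ι ℝ) (T : ι → Matrix ι ι ℝ) (i j k : ι) : ℝ :=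
  ∑ l, ∑ m, ∑ n, T n l m * (K i l * K j m * K k n)

/-- The Wick-ordered cubic form with coefficients `T k i j`. -/
noncomputable def wickForm (K : Matrix ι ι ℝ) (T : ι → Matrix ι ι ℝ) : MvPolynomial ι ℝ :=
  ∑ i, ∑ j, ∑ k, T k i j • wickCubic K i j k

theorem map_wickForm_sq {K : Matrix ι ι ℝ} {L : MvPolynomial ι ℝ →ₗ[ℝ] ℝ}
    (hL : ∀ i p, L (X i * p) = L (covDeriv K i p)) (h1 : L 1 = 1) (T : ι → Matrix ι ι ℝ) :
    L (wickForm K T ^ 2) = ∑ i, ∑ j, ∑ k, T k i j *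
      (raise K T i j k + raise K T j i k + raise K T i k j +
        raise K T k i j + raise K T j k i + raise K T k j i) := by
  have hC : ∀ c : ℝ, L (C c) = c := fun c => by
    rw [← mul_one (C c), ← smul_eq_C_mul, map_smul, h1, smul_eq_mul, mul_one]
  have h : ∀ i j k, L (wickCubic K i j k * wickForm K T) =
      raise K T i j k + raise K T j i k + raise K T i k j +
        raise K T k i j + raise K T j k i + raise K T k j i := fun i j k => by
    rw [map_wickCubic_mul hL, wickForm]
    simp only [map_sum, map_smul, Derivation.map_smul, covDeriv_wickCubic, hC, raise,
      ← Finset.sum_add_distrib, smul_eq_mul, mul_add]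
  rw [sq]
  nth_rw 1 [wickForm]
  simp only [Finset.sum_mul, smul_mul_assoc, map_sum, map_smul, h, smul_eq_mul]

theorem wickForm_sq_eq {S : Matrix ι ι ℝ} {T P : ι → Matrix ι ι ℝ} 
    (hS : S.IsSymm) (hT : ∀ k, (T k).IsSymm) (hP : ∀ k, (P k).IsSymm)
    (hTP : ∀ k, S * T k * S = P k) :
    ∑ i, ∑ j, ∑ k, T k i j *
      (raise ((2:ℝ) • S) T i j k + raise ((2:ℝ) • S) T j i k + raise ((2:ℝ) • S) T i k j +
        raise ((2:ℝ) • S) T k i j + raise ((2:ℝ) • S) T j k i + raise ((2:ℝ) • S) T k j i) =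
    16 * (∑ i, ∑ j, ∑ k, ∑ n, T k i j * (S k n * P n i j)) +
    32 * (∑ i, ∑ j, ∑ k, ∑ n, T k i j * (S j n * P n i k)) := by
  have hr : ∀ i j k, raise ((2:ℝ) • S) T i j k = 8 * ∑ n, S k n * P n i j := fun i j k => by
    have : ∀ n, P n i j = ∑ l, ∑ m, T n l m * (S i l * S j m) := fun n => by
      rw [← hTP n, Matrix.mul_apply, Finset.sum_comm]
      refine Finset.sum_congr rfl fun m _ => ?_
      rw [Matrix.mul_apply, Finset.sum_mul]
      exact Finset.sum_congr rfl fun l _ => by rw [hS.apply m j]; ring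
    simp only [this, raise, Finset.mul_sum, Matrix.smul_apply, smul_eq_mul]
    rw [Finset.sum_comm (s := Finset.univ (α := ι)) (t := Finset.univ)
      (f := fun n l => ∑ m, 8 * (S k n * (T n l m * (S i l * S j m))))]
    refine Finset.sum_congr rfl fun l _ => ?_
    rw [Finset.sum_comm]
    exact Finset.sum_congr rfl fun n _ => Finset.sum_congr rfl fun m _ => by ring
  have hs : ∀ i j k, raise ((2:ℝ) • S) T i j k = raise ((2:ℝ) • S) T j i k := fun i j k => by
    simp only [hr, fun n => (hP n).apply i j]
  have hsw : ∑ i, ∑ j, ∑ k, T k i j * raise ((2:ℝ) • S) T j k i =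
      ∑ i, ∑ j, ∑ k, T k i j * raise ((2:ℝ) • S) T i k j := by
    rw [Finset.sum_comm]
    simp only [fun k i j => (hT k).apply i j]
  have h : ∀ i j k, T k i j *
      (raise ((2:ℝ) • S) T i j k + raise ((2:ℝ) • S) T j i k + raise ((2:ℝ) • S) T i k j +
        raise ((2:ℝ) • S) T k i j + raise ((2:ℝ) • S) T j k i + raise ((2:ℝ) • S) T k j i) =
      2 * (T k i j * raise ((2:ℝ) • S) T i j k) + 2 * (T k i j * raise ((2:ℝ) • S) T i k j) +
      2 * (T k i j * raise ((2:ℝ) • S) T j k i) := fun i j k => by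
    rw [hs j i k, hs k i j, hs k j i]; ring
  simp only [h, Finset.sum_add_distrib, ← Finset.mul_sum, hsw]
  simp only [hr, Finset.mul_sum, ← Finset.sum_add_distrib]
  refine Finset.sum_congr rfl fun i _ => Finset.sum_congr rfl fun j _ =>
    Finset.sum_congr rfl fun k _ => Finset.sum_congr rfl fun n _ => ?_
  ring

end CubicForms

theorem Matrix.IsSymm.inv_real {n : Type*} [Fintype n] [DecidableEq n] {S : Matrix n n ℝ}
    (hS : S.IsSymm) : (S⁻¹).IsSymm := by
  rw [Matrix.IsSymm, Matrix.transpose_nonsing_inv, hS.eq]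

theorem sum_sandwich_first {ι : Type*} [Fintype ι] [DecidableEq ι] (S V : Matrix ι ι ℝ)
    {P : ι → Matrix ι ι ℝ} (hP : ∀ k, (P k).IsSymm) :
    ∑ i, ∑ j, ∑ k, ∑ n, (V * P k * V) i j * (S k n * P n i j) =
      ∑ m, ∑ n, ∑ j, ∑ k, ∑ l, ∑ r, P m j k * V k l * P n l r * V r j * S m n := by
  have h : ∀ m n, ∑ j, ∑ k, ∑ l, ∑ r, P m j k * V k l * P n l r * V r j =
      ∑ i, ∑ j, (V * P m * V) i j * P n i j := fun m n => by
    have hl : Matrix.trace (P m * (V * (P n * V))) =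
        ∑ j, ∑ k, ∑ l, ∑ r, P m j k * V k l * P n l r * V r j := by
      simp only [Matrix.trace, Matrix.diag, Matrix.mul_apply, Finset.mul_sum, mul_assoc]
    have hr : Matrix.trace (V * P m * V * P n) = ∑ i, ∑ j, (V * P m * V) i j * P n i j := by
      simp only [Matrix.trace, Matrix.diag, Matrix.mul_apply (M := V * P m * V)]
      exact Finset.sum_congr rfl fun i _ => Finset.sum_congr rfl fun j _ => by
        rw [(hP n).apply i j]
    rw [← hl, ← hr, Matrix.mul_assoc, Matrix.mul_assoc, Matrix.trace_mul_comm V,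
      Matrix.mul_assoc, Matrix.mul_assoc]
  simp only [← Finset.sum_mul, h]
  calc _ = ∑ i, ∑ k, ∑ n, ∑ j, (V * P k * V) i j * (S k n * P n i j) :=
        Finset.sum_congr rfl fun i _ => by
          rw [Finset.sum_comm]
          exact Finset.sum_congr rfl fun k _ => Finset.sum_comm
    _ = ∑ k, ∑ n, ∑ i, ∑ j, (V * P k * V) i j * (S k n * P n i j) := by
        rw [Finset.sum_comm]
        exact Finset.sum_congr rfl fun k _ => Finset.sum_comm
    _ = _ := by
        simp only [Finset.sum_mul]
        exact Finset.sum_congr rfl fun k _ => Finset.sum_congr rfl fun n _ =>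
          Finset.sum_congr rfl fun i _ => Finset.sum_congr rfl fun j _ => by ring

theorem sum_sandwich_second {ι : Type*} [Fintype ι] [DecidableEq ι] {S V : Matrix ι ι ℝ}
    {P : ι → Matrix ι ι ℝ} (hVS : V * S = 1) (hP : ∀ k, (P k).IsSymm) :
    ∑ i, ∑ j, ∑ k, ∑ n, (V * P k * V) i j * (S j n * P n i k) =
      ∑ m, ∑ s, ∑ k, ∑ l, P m s k * V k l * P s l m := by
  have h : ∀ k, V * P k * V * S = V * P k := fun k => by
    rw [Matrix.mul_assoc, hVS, Matrix.mul_one]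
  calc _ = ∑ i, ∑ k, ∑ n, (V * P k * V * S) i n * P n i k := by
        refine Finset.sum_congr rfl fun i _ => ?_
        rw [Finset.sum_comm]
        refine Finset.sum_congr rfl fun k _ => ?_
        rw [Finset.sum_comm]
        refine Finset.sum_congr rfl fun n _ => ?_
        rw [Matrix.mul_apply, Finset.sum_mul]
        exact Finset.sum_congr rfl fun j _ => by ring
    _ = ∑ i, ∑ k, ∑ n, ∑ a, P n k i * V i a * P k a n := by
        refine Finset.sum_congr rfl fun i _ => Finset.sum_congr rfl fun k _ =>
          Finset.sum_congr rfl fun n _ => ?_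
        rw [h, Matrix.mul_apply, Finset.sum_mul]
        exact Finset.sum_congr rfl fun a _ => by rw [(hP n).apply]; ring
    _ = _ := by
        rw [Finset.sum_comm' (t' := Finset.univ) (s' := fun _ => Finset.univ) (by simp)]
        rw [Finset.sum_congr rfl fun k _ => Finset.sum_comm, Finset.sum_comm]

theorem sum_sandwich_mul {ι : Type*} [Fintype ι] (V P : Matrix ι ι ℝ) (i j : ι) :
    ∑ a, ∑ b, V i a * P a b * V b j = (V * P * V) i j := by
  rw [Matrix.mul_apply, Finset.sum_comm]
  exact Finset.sum_congr rfl fun b _ => by rw [Matrix.mul_apply, Finset.sum_mul]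

theorem eval_wickForm_sandwich {ι : Type*} [Fintype ι] [DecidableEq ι] {S V : Matrix ι ι ℝ}
    {P : ι → Matrix ι ι ℝ} (hS : S.IsSymm) (hV : V.IsSymm) (hVS : V * S = 1)
    (hP : ∀ k, (P k).IsSymm) (ξ : ι → ℝ) :
    MvPolynomial.eval ξ (wickForm ((2:ℝ) • S) fun k => V * P k * V) =
      (∑ i, ∑ j, ∑ k, (∑ a, ∑ b, V i a * P k a b * V b j) * ξ i * ξ j * ξ k) -
        2 * (∑ i, (∑ a, ∑ b, V a b * P i b a) * ξ i) -
        4 * (∑ i, (∑ j, ∑ l, V i j * P l j l) * ξ i) := by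
  have hT : ∀ k, V * P k * V * S = V * P k := fun k => by
    rw [Matrix.mul_assoc, hVS, Matrix.mul_one]
  have hTs : ∀ k i j, (V * P k * V) j i = (V * P k * V) i j := fun k i j => by
    refine Matrix.IsSymm.apply ?_ i j
    rw [Matrix.IsSymm, Matrix.transpose_mul, Matrix.transpose_mul, hV.eq, (hP k).eq,
      Matrix.mul_assoc]
  have h₁ : ∑ i, ∑ j, ∑ k, (V * P k * V) i j * (S i j * ξ k) =
      ∑ i, (∑ a, ∑ b, V a b * P i b a) * ξ i := by
    have : ∀ k, ∑ a, ∑ b, V a b * P k b a = ∑ i, ∑ j, (V * P k * V) i j * S i j := fun k => by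
      refine Finset.sum_congr rfl fun a _ => ?_
      rw [← Matrix.mul_apply, ← congrFun₂ (hT k) a a, Matrix.mul_apply (M := V * P k * V)]
      exact Finset.sum_congr rfl fun b _ => by rw [hS.apply a b]
    simp only [this, Finset.sum_mul]
    rw [Finset.sum_congr rfl fun i _ => Finset.sum_comm, Finset.sum_comm]
    exact Finset.sum_congr rfl fun k _ => Finset.sum_congr rfl fun i _ =>
      Finset.sum_congr rfl fun j _ => by ring
  have h₂ : ∑ i, ∑ j, ∑ k, (V * P k * V) i j * (S j k * ξ i) =
      ∑ i, (∑ j, ∑ l, V i j * P l j l) * ξ i := by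
    refine Finset.sum_congr rfl fun i _ => ?_
    rw [Finset.sum_comm, Finset.sum_comm (f := fun j l => V i j * P l j l), Finset.sum_mul]
    refine Finset.sum_congr rfl fun k _ => ?_
    rw [← Matrix.mul_apply, ← congrFun₂ (hT k) i k, Matrix.mul_apply (M := V * P k * V),
      Finset.sum_mul]
    exact Finset.sum_congr rfl fun j _ => by ring
  have h₃ : ∑ i, ∑ j, ∑ k, (V * P k * V) i j * (S i k * ξ j) =
      ∑ i, (∑ j, ∑ l, V i j * P l j l) * ξ i := by
    rw [← h₂, Finset.sum_comm]
    exact Finset.sum_congr rfl fun i _ => Finset.sum_congr rfl fun j _ =>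
      Finset.sum_congr rfl fun k _ => by rw [hTs]
  have h : ∀ i j k, MvPolynomial.eval ξ
      ((V * P k * V) i j • wickCubic ((2:ℝ) • S) i j k) =
      (V * P k * V) i j * ξ i * ξ j * ξ k - 2 * ((V * P k * V) i j * (S i j * ξ k)) -
        2 * ((V * P k * V) i j * (S i k * ξ j)) - 2 * ((V * P k * V) i j * (S j k * ξ i)) :=
    fun i j k => by
      simp only [wickCubic, MvPolynomial.smul_eval, map_sub, map_mul, MvPolynomial.eval_X,
        Matrix.smul_apply, smul_eq_mul]
      ring
  simp only [wickForm, map_sum, h, Finset.sum_sub_distrib, ← Finset.mul_sum, h₁, h₂, h₃,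
    sum_sandwich_mul]
  ring

theorem isSymm_pd {d : ℕ} {U : Set (Fin d → ℝ)} (hU : IsOpen U) {x₀ : Fin d → ℝ} (hx₀ : x₀ ∈ U)
    {D : (Fin d → ℝ) → Matrix (Fin d) (Fin d) ℝ} (hsymm : ∀ x ∈ U, (D x).IsSymm) (k : Fin d) :
    (Matrix.of fun a b => pd (fun x => D x a b) k x₀).IsSymm := by
  refine Matrix.IsSymm.ext fun a b => ?_
  have h : (fun x => D x b a) =ᶠ[nhds x₀] fun x => D x a b := by
    filter_upwards [hU.mem_nhds hx₀] with x hx using (hsymm x hx).apply a b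
  simp only [Matrix.of_apply, pd, h.fderiv_eq]

/-- `½ ⟨(𝒜^{1/2}(ξ))²⟩₀ = α² [ ½ (∂_m D^{jk}) D⁻¹_{kl} (∂_n D^{lr}) D⁻¹_{rj} D^{mn}
    + (∂_m D^{sk}) D⁻¹_{kl} (∂_s D^{lm}) ]`, all quantities evaluated at `x₀`. -/
theorem Ahalf_sq_mean (d : ℕ) (hd : 1 ≤ d)
    (U : Set (Fin d → ℝ)) (hU : IsOpen U) (x₀ : Fin d → ℝ) (hx₀ : x₀ ∈ U)
    (α : ℝ)
    (D : (Fin d → ℝ) → Matrix (Fin d) (Fin d) ℝ)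
    (hsymm : ∀ x ∈ U, (D x).IsSymm) (hpos : ∀ x ∈ U, (D x).PosDef)
    (hC2 : ∀ i j, ContDiffOn ℝ 2 (fun x => D x i j) U) :
    (1/2) * (∫ ξ : Fin d → ℝ, (Ahalf d α D x₀ ξ)^2 * gaussDensity d (D x₀) ξ) =
      α^2 * ((1/2) * (∑ m, ∑ n, ∑ j, ∑ k, ∑ l, ∑ r,
          pd (fun x => D x j k) m x₀ * (D x₀)⁻¹ k l *
            pd (fun x => D x l r) n x₀ * (D x₀)⁻¹ r j * D x₀ m n)
        + (∑ m, ∑ s, ∑ k, ∑ l,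
          pd (fun x => D x s k) m x₀ * (D x₀)⁻¹ k l *
            pd (fun x => D x l m) s x₀)) := by
  set S := D x₀ with hSdef
  set V := S⁻¹ with hVdef
  set P : Fin d → Matrix (Fin d) (Fin d) ℝ :=
    fun k => Matrix.of fun a b => pd (fun x => D x a b) k x₀ with hPdef
  have hS : S.IsSymm := hsymm x₀ hx₀
  have hV : V.IsSymm := hS.inv_real
  have hdet : IsUnit S.det := (hpos x₀ hx₀).det_pos.ne'.isUnit
  have hVS : V * S = 1 := Matrix.nonsing_inv_mul _ hdet
  have hSV : S * V = 1 := Matrix.mul_nonsing_inv _ hdet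
  have hP : ∀ k, (P k).IsSymm := isSymm_pd hU hx₀ hsymm
  obtain ⟨B, hB⟩ := (hpos x₀ hx₀).exists_eq_mul_transpose
  have hBdet : B.det ≠ 0 := fun h => hdet.ne_zero (by
    rw [hSdef, hB, Matrix.det_mul, h, zero_mul])
  have hA : ∀ ξ, Ahalf d α D x₀ ξ ^ 2 * gaussDensity d S ξ = α ^ 2 / 16 *
      (MvPolynomial.eval ξ (wickForm ((2:ℝ) • S) (fun k => V * P k * V) ^ 2) *
        gaussDensity d (B * B.transpose) ξ) := fun ξ => by
    have : Ahalf d α D x₀ ξ =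
        -(α / 4) * MvPolynomial.eval ξ (wickForm ((2:ℝ) • S) fun k => V * P k * V) := by
      rw [eval_wickForm_sandwich hS hV hVS hP]
      simp only [Ahalf, hPdef, Matrix.of_apply]
      ring
    rw [this, map_pow, ← hB]
    ring
  have hL : ∀ i p, (heatMean (Fin d) ∘ₗ (linSubst B).toLinearMap) (MvPolynomial.X i * p) =
      (heatMean (Fin d) ∘ₗ (linSubst B).toLinearMap) (covDeriv ((2:ℝ) • S) i p) := fun i p => by
    simp only [LinearMap.comp_apply, AlgHom.toLinearMap_apply, heatMean_linSubst_X_mul,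
      covDeriv_eq_sum_pderiv, map_sum, map_smul, ← hB, Matrix.smul_apply, smul_eq_mul]
    rfl
  have hmean := map_wickForm_sq hL (by simp [heatMean_one]) fun k => V * P k * V
  rw [wickForm_sq_eq hS (fun k => ?_) hP (fun k => ?_), sum_sandwich_first S V hP,
    sum_sandwich_second hVS hP] at hmean
  · simp only [hA, integral_const_mul, integral_eval_mul_gaussDensity B hBdet]
    change 1 / 2 * (α ^ 2 / 16 * (heatMean (Fin d) ∘ₗ (linSubst B).toLinearMap) _) = _
    rw [hmean]
    simp only [hPdef, Matrix.of_apply]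
    ring
  · rw [Matrix.IsSymm, Matrix.transpose_mul, Matrix.transpose_mul, hV.eq, (hP k).eq,
      Matrix.mul_assoc]
  · rw [← Matrix.mul_assoc, ← Matrix.mul_assoc, hSV, Matrix.one_mul, Matrix.mul_assoc, hVS,
      Matrix.mul_one]
end

section
/- The Gaussian expectations satisfy ⟨𝒜¹(ξ)⟩₀ − ½ ⟨(𝒜^{1/2}(ξ))²⟩₀ = 0, where 𝒜¹ = 𝒜^{1,1} + 𝒜^{1,2} + 𝒜^{1,3} + 𝒜^{1,4} + α ∂_i F^i − α² ∂_i ∂_j D^{ij}. -/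
open MeasureTheory Real

/-- `𝒜^{1,1}(ξ)`. -/
noncomputable def A11 (d : ℕ) (α : ℝ)
    (D : (Fin d → ℝ) → Matrix (Fin d) (Fin d) ℝ)
    (F : (Fin d → ℝ) → Fin d → ℝ) (x₀ : Fin d → ℝ)
    (ξ : Fin d → ℝ) : ℝ :=
  -(α/4) * (∑ i, ∑ j, ∑ k,
      (∑ a, ∑ b, (D x₀)⁻¹ i a * pd (fun x => D x a b) k x₀ * (D x₀)⁻¹ b j) *
        F x₀ k * ξ i * ξ j)
  + (α/2) * (∑ i, (∑ a, ∑ b, (D x₀)⁻¹ a b * pd (fun x => D x b a) i x₀) * F x₀ i)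

/-- `𝒜^{1,2}(ξ)`. -/
noncomputable def A12 (d : ℕ) (α : ℝ)
    (D : (Fin d → ℝ) → Matrix (Fin d) (Fin d) ℝ)
    (F : (Fin d → ℝ) → Fin d → ℝ) (x₀ : Fin d → ℝ)
    (ξ : Fin d → ℝ) : ℝ :=
  -(α/2) * (∑ k, ∑ j,
    (∑ i, pd (fun x => F x i) k x₀ * (D x₀)⁻¹ i j) * ξ k * ξ j)

/-- `𝒜^{1,4}(ξ)`. -/
noncomputable def A14 (d : ℕ) (α : ℝ)
    (D : (Fin d → ℝ) → Matrix (Fin d) (Fin d) ℝ) (x₀ : Fin d → ℝ)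
    (ξ : Fin d → ℝ) : ℝ :=
  (α^2/4) * (∑ i, ∑ j, ∑ m, ∑ n,
      (∑ a, ∑ b, ∑ c, ∑ e,
        (D x₀)⁻¹ m a * pd (fun x => D x a b) i x₀ * (D x₀)⁻¹ b c *
          pd (fun x => D x c e) j x₀ * (D x₀)⁻¹ e n) * ξ i * ξ j * ξ m * ξ n)
  - (α^2/4) * (∑ i, ∑ j,
      (∑ a, ∑ b, ∑ c, ∑ e,
        (D x₀)⁻¹ a b * pd (fun x => D x b c) i x₀ * (D x₀)⁻¹ c e *
          pd (fun x => D x e a) j x₀) * ξ i * ξ j)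
  - α^2 * (∑ k, ∑ j,
      (∑ i, ∑ l, pd (fun x => D x i l) l x₀ *
        (∑ a, ∑ b, (D x₀)⁻¹ i a * pd (fun x => D x a b) k x₀ * (D x₀)⁻¹ b j)) *
          ξ k * ξ j)
  + α^2 * (∑ i, ∑ j, ∑ l, ∑ m,
      pd (fun x => D x i l) l x₀ * (D x₀)⁻¹ i j * pd (fun x => D x j m) m x₀)

/-- `𝒜¹(ξ) = 𝒜^{1,1} + 𝒜^{1,2} + 𝒜^{1,3} + 𝒜^{1,4} + α ∂_i F^i − α² ∂_i ∂_j D^{ij}`. -/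
noncomputable def Aone (d : ℕ) (α : ℝ)
    (D : (Fin d → ℝ) → Matrix (Fin d) (Fin d) ℝ)
    (F : (Fin d → ℝ) → Fin d → ℝ) (x₀ : Fin d → ℝ)
    (ξ : Fin d → ℝ) : ℝ :=
  A11 d α D F x₀ ξ + A12 d α D F x₀ ξ + A13 d α D x₀ ξ + A14 d α D x₀ ξ
    + α * (∑ i, pd (fun x => F x i) i x₀)
    - α^2 * (∑ i, ∑ j, pd2 (fun x => D x i j) i j x₀)


section GaussianMoments

open MvPolynomial

variable {d : ℕ}

/-- A positive definite quadratic form dominates a multiple of the sum of squares. -/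
lemma Matrix.PosDef.exists_pos_mul_sum_sq_le {K : Matrix (Fin d) (Fin d) ℝ} (hK : K.PosDef) :
    ∃ c > 0, ∀ ξ : Fin d → ℝ, c * ∑ i, ξ i ^ 2 ≤ ∑ i, ∑ j, ξ i * K i j * ξ j := by
  have hpos : ∀ ξ : Fin d → ℝ, ξ ≠ 0 → 0 < ∑ i, ∑ j, ξ i * K i j * ξ j := fun ξ hξ ↦ by
    have h := hK.dotProduct_mulVec_pos hξ
    simpa [dotProduct, Matrix.mulVec, Finset.mul_sum, mul_assoc] using h
  have hsq : ∀ ξ : Fin d → ℝ, ξ ≠ 0 → 0 < ∑ i, ξ i ^ 2 := fun ξ hξ ↦ by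
    obtain ⟨i, hi⟩ := Function.ne_iff.mp hξ
    exact Finset.sum_pos' (fun _ _ ↦ sq_nonneg _) ⟨i, Finset.mem_univ _, sq_pos_of_ne_zero hi⟩
  have hne : ∀ ξ ∈ Metric.sphere (0 : Fin d → ℝ) 1, ξ ≠ 0 := fun ξ hξ ↦
    ne_zero_of_mem_unit_sphere ⟨ξ, hξ⟩
  rcases (Metric.sphere (0 : Fin d → ℝ) 1).eq_empty_or_nonempty with hemp | hS
  · refine ⟨1, one_pos, fun ξ ↦ ?_⟩
    have : ξ = 0 := by
      by_contra h
      have : (‖ξ‖⁻¹ • ξ) ∈ Metric.sphere (0 : Fin d → ℝ) 1 := by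
        simp [norm_smul, h]
      simp [hemp] at this
    simp [this]
  · obtain ⟨ξ₀, hξ₀, hmin⟩ := (isCompact_sphere (0 : Fin d → ℝ) 1).exists_isMinOn hS
      (f := fun ξ ↦ (∑ i, ∑ j, ξ i * K i j * ξ j) / ∑ i, ξ i ^ 2)
      (ContinuousOn.div (by fun_prop) (by fun_prop) fun ξ hξ ↦ (hsq ξ (hne ξ hξ)).ne')
    refine ⟨_, div_pos (hpos ξ₀ (hne _ hξ₀)) (hsq ξ₀ (hne _ hξ₀)), fun ξ ↦ ?_⟩
    by_cases h : ξ = 0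
    · simp [h]
    have hm : (‖ξ‖⁻¹ • ξ) ∈ Metric.sphere (0 : Fin d → ℝ) 1 := by simp [norm_smul, h]
    have := hmin hm
    simp only [Set.mem_ofPred_eq] at this
    rw [le_div_iff₀ (hsq _ (hne _ hm))] at this
    have hn : 0 < ‖ξ‖⁻¹ := by simpa using h
    have e1 : ∑ i, (‖ξ‖⁻¹ • ξ) i ^ 2 = ‖ξ‖⁻¹ ^ 2 * ∑ i, ξ i ^ 2 := by
      simp [Finset.mul_sum, mul_pow]
    have e2 : ∑ i, ∑ j, (‖ξ‖⁻¹ • ξ) i * K i j * (‖ξ‖⁻¹ • ξ) j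
        = ‖ξ‖⁻¹ ^ 2 * ∑ i, ∑ j, ξ i * K i j * ξ j := by
      simp only [Finset.mul_sum, Pi.smul_apply, smul_eq_mul]
      exact Finset.sum_congr rfl fun i _ ↦ Finset.sum_congr rfl fun j _ ↦ by ring
    rw [e1, e2, mul_left_comm] at this
    exact le_of_mul_le_mul_left this (by positivity)

lemma continuous_gaussDensity (A : Matrix (Fin d) (Fin d) ℝ) :
    Continuous (gaussDensity d A) := by
  unfold gaussDensity
  fun_prop

lemma integrable_pow_mul_exp_neg_mul_sq {c : ℝ} (hc : 0 < c) (n : ℕ) :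
    Integrable fun x : ℝ ↦ x ^ n * Real.exp (-c * x ^ 2) := by
  simpa using integrable_rpow_mul_exp_neg_mul_sq hc (s := n)
    (lt_of_lt_of_le (by norm_num) (Nat.cast_nonneg n))

/-- Polynomials are integrable against a nondegenerate Gaussian density. -/
lemma integrable_eval_mul_gaussDensity {A : Matrix (Fin d) (Fin d) ℝ} (hA : A.PosDef)
    (P : MvPolynomial (Fin d) ℝ) :
    Integrable fun ξ : Fin d → ℝ ↦ eval ξ P * gaussDensity d A ξ := by
  obtain ⟨c, hc, hle⟩ := hA.inv.exists_pos_mul_sum_sq_le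
  induction P using MvPolynomial.induction_on' with
  | monomial s a =>
    have hprod : Integrable fun ξ : Fin d → ℝ ↦
        ∏ i, (ξ i ^ s i * Real.exp (-(c / 4) * ξ i ^ 2)) :=
      Integrable.fintype_prod (f := fun i x ↦ x ^ s i * Real.exp (-(c / 4) * x ^ 2))
        fun i ↦ integrable_pow_mul_exp_neg_mul_sq (by positivity) _
    refine (hprod.const_mul (a * (Real.sqrt ((4 * π) ^ d * A.det))⁻¹)).mono
      (((MvPolynomial.continuous_eval _).mul
        (continuous_gaussDensity A)).aestronglyMeasurable) (.of_forall fun ξ ↦ ?_)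
    rw [eval_monomial, Finsupp.prod_fintype _ _ (by simp), Finset.prod_mul_distrib,
      ← Real.exp_sum, ← Finset.mul_sum, gaussDensity]
    simp only [norm_mul, Real.norm_eq_abs, Real.abs_exp]
    have : Real.exp (-(1/4) * ∑ i, ∑ j, ξ i * A⁻¹ i j * ξ j)
        ≤ Real.exp (-(c / 4) * ∑ i, ξ i ^ 2) := by
      refine Real.exp_le_exp.mpr ?_
      have := hle ξ
      linarith
    calc _ = |a| * |(√((4 * π) ^ d * A.det))⁻¹| * (|∏ i, ξ i ^ s i| *
          Real.exp (-(1/4) * ∑ i, ∑ j, ξ i * A⁻¹ i j * ξ j)) := by ring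
      _ ≤ _ := by gcongr
  | add p q hp hq =>
    simp only [map_add, add_mul]
    exact Integrable.add hp hq

lemma MvPolynomial.differentiable_eval (P : MvPolynomial (Fin d) ℝ) :
    Differentiable ℝ fun ξ : Fin d → ℝ ↦ eval ξ P := by
  induction P using MvPolynomial.induction_on with
  | C a => simp
  | add p q hp hq => simpa only [map_add] using hp.fun_add hq
  | mul_X p i hp => simpa only [map_mul, eval_X] using hp.fun_mul (differentiable_apply i)

lemma MvPolynomial.fderiv_eval_single (P : MvPolynomial (Fin d) ℝ) (ξ : Fin d → ℝ) (k : Fin d) :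
    fderiv ℝ (fun ξ : Fin d → ℝ ↦ eval ξ P) ξ (Pi.single k 1) = eval ξ (pderiv k P) := by
  induction P using MvPolynomial.induction_on with
  | C a => simp
  | add p q hp hq =>
    simp only [map_add]
    rw [fderiv_fun_add (p.differentiable_eval ξ) (q.differentiable_eval ξ)]
    simp [hp, hq]
  | mul_X p i hp =>
    simp only [map_mul, eval_X]
    rw [fderiv_fun_mul (p.differentiable_eval ξ) (differentiableAt_apply i ξ)]
    simp [hp, pderiv_X, fderiv_apply, Pi.single_apply, eq_comm]
    split_ifs <;> simp

lemma differentiable_gaussDensity (A : Matrix (Fin d) (Fin d) ℝ) :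
    Differentiable ℝ (gaussDensity d A) := by
  unfold gaussDensity
  fun_prop

lemma fderiv_gaussDensity_single {A : Matrix (Fin d) (Fin d) ℝ} (hA : A⁻¹.IsSymm)
    (ξ : Fin d → ℝ) (k : Fin d) :
    fderiv ℝ (gaussDensity d A) ξ (Pi.single k 1)
      = -(1 / 2) * (∑ j, A⁻¹ k j * ξ j) * gaussDensity d A ξ := by
  set Q : MvPolynomial (Fin d) ℝ := ∑ i, ∑ j, X i * C (A⁻¹ i j) * X j with hQ
  have hq : ∀ η : Fin d → ℝ, ∑ i, ∑ j, η i * A⁻¹ i j * η j = eval η Q := by simp [hQ]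
  have hd : eval ξ (pderiv k Q) = 2 * ∑ j, A⁻¹ k j * ξ j := by
    have : ∀ i, A⁻¹ i k = A⁻¹ k i := fun i ↦ hA.apply k i
    simp only [hQ, map_sum, pderiv_mul, pderiv_C, pderiv_X, Pi.single_apply, map_add, map_mul,
      eval_X, eval_C, apply_ite (eval ξ), map_one, map_zero, Finset.sum_add_distrib, two_mul,
      mul_zero, add_zero]
    congr 1
    · rw [Finset.sum_comm]
      simp
    · simp [this, mul_comm]
  unfold gaussDensity
  simp only [hq]
  have h1 := ((Q.differentiable_eval ξ).hasFDerivAt.const_mul (-(1 / 4 : ℝ))).exp.const_mul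
    (Real.sqrt ((4 * π) ^ d * A.det))⁻¹
  rw [h1.fderiv]
  simp only [_root_.smul_apply, smul_eq_mul, MvPolynomial.fderiv_eval_single, hd]
  ring

/-- Integration of polynomials against the Gaussian density, as a linear functional. -/
noncomputable def gaussMoment {A : Matrix (Fin d) (Fin d) ℝ} (hA : A.PosDef) :
    MvPolynomial (Fin d) ℝ →ₗ[ℝ] ℝ where
  toFun P := ∫ ξ : Fin d → ℝ, eval ξ P * gaussDensity d A ξ
  map_add' P Q := by
    simp only [map_add, add_mul]
    exact integral_add (integrable_eval_mul_gaussDensity hA P)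
      (integrable_eval_mul_gaussDensity hA Q)
  map_smul' c P := by
    simp only [smul_eval, mul_assoc, RingHom.id_apply, smul_eq_mul]
    exact integral_const_mul _ _

lemma gaussMoment_apply {A : Matrix (Fin d) (Fin d) ℝ} (hA : A.PosDef)
    (P : MvPolynomial (Fin d) ℝ) :
    gaussMoment hA P = ∫ ξ : Fin d → ℝ, eval ξ P * gaussDensity d A ξ := rfl

lemma gaussMoment_pderiv {A : Matrix (Fin d) (Fin d) ℝ} (hA : A.PosDef)
    (P : MvPolynomial (Fin d) ℝ) (k : Fin d) :
    gaussMoment hA (∑ j, A⁻¹ k j • (X j * P)) = 2 * gaussMoment hA (pderiv k P) := by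
  have hsymm : A⁻¹.IsSymm := by simpa using hA.inv.isHermitian
  have hfun : ∀ ξ : Fin d → ℝ, eval ξ P * fderiv ℝ (gaussDensity d A) ξ (Pi.single k 1)
      = eval ξ ((-(1 / 2 : ℝ)) • ∑ j, A⁻¹ k j • (X j * P)) * gaussDensity d A ξ := fun ξ ↦ by
    rw [fderiv_gaussDensity_single hsymm]
    simp only [smul_eval, map_sum, map_mul, eval_X, ← mul_assoc, ← Finset.sum_mul]
    ring
  have key := integral_mul_fderiv_eq_neg_fderiv_mul_of_integrable (μ := volume)
    (f := fun ξ : Fin d → ℝ ↦ eval ξ P) (g := gaussDensity d A) (v := Pi.single k 1)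
    (by simpa only [MvPolynomial.fderiv_eval_single] using
      integrable_eval_mul_gaussDensity hA (pderiv k P))
    (by simpa only [hfun] using integrable_eval_mul_gaussDensity hA _)
    (integrable_eval_mul_gaussDensity hA P)
    (fun ξ _ ↦ P.differentiable_eval ξ) (fun ξ _ ↦ differentiable_gaussDensity A ξ)
  simp only [hfun, MvPolynomial.fderiv_eval_single, ← gaussMoment_apply hA, map_smul,
    smul_eq_mul] at key
  linarith

/-- Gaussian integration by parts (Stein's identity) for polynomials. -/
lemma gaussMoment_X_mul {A : Matrix (Fin d) (Fin d) ℝ} (hA : A.PosDef)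
    (P : MvPolynomial (Fin d) ℝ) (i : Fin d) :
    gaussMoment hA (X i * P) = ∑ k, 2 * A i k * gaussMoment hA (pderiv k P) := by
  have hmul : A * A⁻¹ = 1 := Matrix.mul_nonsing_inv _ hA.det_pos.ne'.isUnit
  calc gaussMoment hA (X i * P)
      = ∑ j, (A * A⁻¹) i j * gaussMoment hA (X j * P) := by simp [hmul, Matrix.one_apply]
    _ = ∑ k, A i k * gaussMoment hA (∑ j, A⁻¹ k j • (X j * P)) := by
      simp only [Matrix.mul_apply, Finset.sum_mul, map_sum, map_smul, smul_eq_mul,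
        Finset.mul_sum, mul_assoc]
      exact Finset.sum_comm
    _ = _ := Finset.sum_congr rfl fun k _ ↦ by rw [gaussMoment_pderiv]; ring

lemma gaussMoment_X_mul' {A : Matrix (Fin d) (Fin d) ℝ} (hA : A.PosDef)
    (P : MvPolynomial (Fin d) ℝ) (i : Fin d) :
    gaussMoment hA (X i * P) = ∑ k, 2 * A i k * gaussMoment hA (1 * pderiv k P) := by
  simp only [one_mul, gaussMoment_X_mul]

lemma sum_gaussMoment_mul_pderiv_X_mul {A : Matrix (Fin d) (Fin d) ℝ} (hA : A.PosDef)
    (P Q : MvPolynomial (Fin d) ℝ) (i j : Fin d) :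
    ∑ k, 2 * A i k * gaussMoment hA (Q * pderiv k (X j * P)) =
      2 * A i j * gaussMoment hA (Q * P)
        + ∑ k, 2 * A i k * gaussMoment hA (Q * X j * pderiv k P) := by
  have h : ∀ k, gaussMoment hA (Q * pderiv k (X j * P))
      = (if k = j then gaussMoment hA (Q * P) else 0) + gaussMoment hA (Q * X j * pderiv k P) := by
    intro k
    rw [pderiv_mul, mul_add, map_add, pderiv_X, mul_assoc]
    by_cases hk : k = j
    · subst hk; simp
    · rw [Pi.single_eq_of_ne (Ne.symm hk)]; simp [hk]
  simp only [h, mul_add, Finset.sum_add_distrib, mul_ite, mul_zero, Finset.sum_ite_eq',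
    Finset.mem_univ, if_true]

lemma gaussMoment_two {A : Matrix (Fin d) (Fin d) ℝ} (hA : A.PosDef) (i j : Fin d) :
    gaussMoment hA (X i * X j) = 2 * A i j * gaussMoment hA 1 := by
  simpa [gaussMoment_X_mul] using sum_gaussMoment_mul_pderiv_X_mul hA 1 1 i j

lemma gaussMoment_four {A : Matrix (Fin d) (Fin d) ℝ} (hA : A.PosDef) (i j k l : Fin d) :
    gaussMoment hA (X i * X j * X k * X l) =
      4 * (A i j * A k l + A i k * A j l + A i l * A j k) * gaussMoment hA 1 := by
  rw [show (X i * X j * X k * X l : MvPolynomial (Fin d) ℝ)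
    = X i * (X j * (X k * (X l * 1))) by ring]
  rw [gaussMoment_X_mul', sum_gaussMoment_mul_pderiv_X_mul, sum_gaussMoment_mul_pderiv_X_mul,
    sum_gaussMoment_mul_pderiv_X_mul]
  simp only [one_mul, mul_one, pderiv_one, mul_zero, map_zero, Finset.sum_const_zero, add_zero,
    gaussMoment_two]
  ring

lemma gaussMoment_six {A : Matrix (Fin d) (Fin d) ℝ} (hA : A.PosDef) (i j k l m n : Fin d) :
    gaussMoment hA (X i * X j * X k * X l * X m * X n) =
      8 * (A i j * (A k l * A m n + A k m * A l n + A k n * A l m)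
        + A i k * (A j l * A m n + A j m * A l n + A j n * A l m)
        + A i l * (A j k * A m n + A j m * A k n + A j n * A k m)
        + A i m * (A j k * A l n + A j l * A k n + A j n * A k l)
        + A i n * (A j k * A l m + A j l * A k m + A j m * A k l)) * gaussMoment hA 1 := by
  rw [show (X i * X j * X k * X l * X m * X n : MvPolynomial (Fin d) ℝ)
    = X i * (X j * (X k * (X l * (X m * (X n * 1))))) by ring]
  rw [gaussMoment_X_mul', sum_gaussMoment_mul_pderiv_X_mul, sum_gaussMoment_mul_pderiv_X_mul,
    sum_gaussMoment_mul_pderiv_X_mul, sum_gaussMoment_mul_pderiv_X_mul,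
    sum_gaussMoment_mul_pderiv_X_mul]
  simp only [one_mul, mul_one, pderiv_one, mul_zero, map_zero, Finset.sum_const_zero, add_zero,
    ← mul_assoc, gaussMoment_four]
  ring

end GaussianMoments

section TensorContractions

open Matrix

variable {ι : Type*} [Fintype ι]

lemma sum_four_eq_sum_prod (f : ι → ι → ι → ι → ℝ) :
    ∑ a, ∑ b, ∑ c, ∑ d, f a b c d =
      ∑ x : ι × ι × ι × ι, f x.1 x.2.1 x.2.2.1 x.2.2.2 := by
  simp only [Fintype.sum_prod_type]

lemma sum_six_eq_sum_prod (f : ι → ι → ι → ι → ι → ι → ℝ) :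
    ∑ a, ∑ b, ∑ c, ∑ d, ∑ e, ∑ g, f a b c d e g =
      ∑ x : ι × ι × ι × ι × ι × ι,
        f x.1 x.2.1 x.2.2.1 x.2.2.2.1 x.2.2.2.2.1 x.2.2.2.2.2 := by
  simp only [Fintype.sum_prod_type]

/-- Pairing of `T ⊗ T` with a six-index array, the last index of each `T` being the matrix label. -/
noncomputable def tensorPairing (T : ι → Matrix ι ι ℝ) (p : ι → ι → ι → ι → ι → ι → ℝ) : ℝ :=
  ∑ i, ∑ j, ∑ k, ∑ l, ∑ m, ∑ n, T k i j * T n l m * p i j k l m n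

variable {T : ι → Matrix ι ι ℝ} {A : Matrix ι ι ℝ}

lemma tensorPairing_add (p q : ι → ι → ι → ι → ι → ι → ℝ) :
    tensorPairing T (fun i j k l m n ↦ p i j k l m n + q i j k l m n)
      = tensorPairing T p + tensorPairing T q := by
  simp only [tensorPairing, mul_add, Finset.sum_add_distrib]

lemma tensorPairing_swap_left (hT : ∀ k i j, T k i j = T k j i)
    (p : ι → ι → ι → ι → ι → ι → ℝ) :
    tensorPairing T p = tensorPairing T fun i j k l m n ↦ p j i k l m n := by
  rw [tensorPairing, Finset.sum_comm]
  simp only [tensorPairing]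
  congr! 6 with i _ j _ k _
  simp only [hT k j i]

lemma tensorPairing_swap (p : ι → ι → ι → ι → ι → ι → ℝ) :
    tensorPairing T p = tensorPairing T fun i j k l m n ↦ p l m n i j k := by
  simp only [tensorPairing, sum_six_eq_sum_prod]
  refine Fintype.sum_equiv ⟨fun (i, j, k, l, m, n) ↦ (l, m, n, i, j, k),
    fun (i, j, k, l, m, n) ↦ (l, m, n, i, j, k), fun _ ↦ rfl, fun _ ↦ rfl⟩ _ _ fun x ↦ ?_
  simp only [Equiv.coe_fn_mk]
  ring

lemma tensorPairing_swap_right (hT : ∀ k i j, T k i j = T k j i)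
    (p : ι → ι → ι → ι → ι → ι → ℝ) :
    tensorPairing T p = tensorPairing T fun i j k l m n ↦ p i j k m l n := by
  rw [tensorPairing_swap, tensorPairing_swap_left hT, tensorPairing_swap]

/-- The fifteen pairings of a symmetric `T ⊗ T` reduce to five contractions. -/
lemma tensorPairing_wick (hT : ∀ k i j, T k i j = T k j i) (hA : ∀ i j, A i j = A j i) :
    tensorPairing T (fun i j k l m n ↦
        A i j * (A k l * A m n + A k m * A l n + A k n * A l m)
        + A i k * (A j l * A m n + A j m * A l n + A j n * A l m)
        + A i l * (A j k * A m n + A j m * A k n + A j n * A k m)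
        + A i m * (A j k * A l n + A j l * A k n + A j n * A k l)
        + A i n * (A j k * A l m + A j l * A k m + A j m * A k l)) =
      tensorPairing T (fun i j k l m n ↦ A i j * A l m * A k n)
      + 4 * tensorPairing T (fun i j k l m n ↦ A i k * A l m * A j n)
      + 4 * tensorPairing T (fun i j k l m n ↦ A i k * A l n * A j m)
      + 2 * tensorPairing T (fun i j k l m n ↦ A k n * A i l * A j m)
      + 4 * tensorPairing T (fun i j k l m n ↦ A k m * A j n * A i l) := by
  have uv₁ := tensorPairing_swap_left hT fun i j k l m n ↦ A i k * A l m * A j n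
  have uv₂ := tensorPairing_swap (T := T) fun i j k l m n ↦ A i k * A l m * A j n
  have uv₃ := uv₂.trans (tensorPairing_swap_right hT _)
  have uu₁ := tensorPairing_swap_left hT fun i j k l m n ↦ A i k * A l n * A j m
  have uu₂ := tensorPairing_swap_right hT fun i j k l m n ↦ A i k * A l n * A j m
  have uu₃ := uu₁.trans (tensorPairing_swap_right hT _)
  have s₁ := tensorPairing_swap_left hT fun i j k l m n ↦ A k n * A i l * A j m
  have q₁ := tensorPairing_swap_left hT fun i j k l m n ↦ A k m * A j n * A i l
  have q₂ := tensorPairing_swap_right hT fun i j k l m n ↦ A k m * A j n * A i l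
  have q₃ := q₁.trans (tensorPairing_swap_right hT _)
  have split (x₁ x₂ x₃ x₄ x₅ : ℝ) : x₁ + 4 * x₂ + 4 * x₃ + 2 * x₄ + 4 * x₅
    = x₁ + (x₂ + x₂ + x₂ + x₂) + (x₃ + x₃ + x₃ + x₃) + (x₄ + x₄) + (x₅ + x₅ + x₅ + x₅) := by ring
  rw [split]
  nth_rw 2 [uv₁]
  nth_rw 2 [uv₂]
  nth_rw 2 [uv₃]
  nth_rw 2 [uu₁]
  nth_rw 2 [uu₂]
  nth_rw 2 [uu₃]
  nth_rw 2 [s₁]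
  nth_rw 2 [q₁]
  nth_rw 2 [q₂]
  nth_rw 2 [q₃]
  simp only [← tensorPairing_add]
  congr! 7 with i j k l m n
  rw [hA m k, hA l k]
  ring

variable {u v : ι → ℝ}

lemma tensorPairing_trace_trace (hv : ∀ k, v k = ∑ i, ∑ j, T k i j * A i j) :
    tensorPairing T (fun i j k l m n ↦ A i j * A l m * A k n) = v ⬝ᵥ A *ᵥ v := by
  simp only [dotProduct, Matrix.mulVec, hv, Finset.sum_mul]
  simp only [Finset.mul_sum, tensorPairing]
  simp only [sum_six_eq_sum_prod]
  refine Fintype.sum_equiv ⟨fun (i, j, k, l, m, n) ↦ (k, i, j, n, l, m),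
    fun (k, i, j, n, l, m) ↦ (i, j, k, l, m, n), fun _ ↦ rfl, fun _ ↦ rfl⟩ _ _ fun x ↦ ?_
  simp only [Equiv.coe_fn_mk]
  ring

lemma tensorPairing_div_trace (hT : ∀ k i j, T k i j = T k j i)
    (hu : ∀ i, u i = ∑ k, ∑ j, T k i j * A j k) (hv : ∀ k, v k = ∑ i, ∑ j, T k i j * A i j) :
    tensorPairing T (fun i j k l m n ↦ A i k * A l m * A j n) = u ⬝ᵥ A *ᵥ v := by
  simp only [dotProduct, Matrix.mulVec, hu, hv, Finset.sum_mul]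
  simp only [Finset.mul_sum, tensorPairing]
  simp only [sum_six_eq_sum_prod]
  refine Fintype.sum_equiv ⟨fun (i, j, k, l, m, n) ↦ (j, k, i, n, l, m),
    fun (j, k, i, n, l, m) ↦ (i, j, k, l, m, n), fun _ ↦ rfl, fun _ ↦ rfl⟩ _ _ fun x ↦ ?_
  simp only [Equiv.coe_fn_mk]
  rw [hT _ x.1]
  ring

lemma tensorPairing_div_div (hT : ∀ k i j, T k i j = T k j i)
    (hu : ∀ i, u i = ∑ k, ∑ j, T k i j * A j k) :
    tensorPairing T (fun i j k l m n ↦ A i k * A l n * A j m) = u ⬝ᵥ A *ᵥ u := by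
  simp only [dotProduct, Matrix.mulVec, hu, Finset.sum_mul]
  simp only [Finset.mul_sum, tensorPairing]
  simp only [sum_six_eq_sum_prod]
  refine Fintype.sum_equiv ⟨fun (i, j, k, l, m, n) ↦ (j, k, i, m, n, l),
    fun (j, k, i, m, n, l) ↦ (i, j, k, l, m, n), fun _ ↦ rfl, fun _ ↦ rfl⟩ _ _ fun x ↦ ?_
  simp only [Equiv.coe_fn_mk]
  rw [hT _ x.1, hT _ x.2.2.2.1]
  ring

lemma sum_trace_mul_eq_tensorPairing (hT : ∀ k i j, T k i j = T k j i)
    (hA : ∀ i j, A i j = A j i) :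
    ∑ i, ∑ j, (∑ a, ∑ b, ∑ c, ∑ e, T i a b * A b c * T j c e * A e a) * A i j =
      tensorPairing T (fun i j k l m n ↦ A k n * A i l * A j m) := by
  simp only [Finset.sum_mul, tensorPairing, sum_six_eq_sum_prod]
  refine Fintype.sum_equiv ⟨fun (i, j, a, b, c, e) ↦ (a, b, i, e, c, j),
    fun (a, b, i, e, c, j) ↦ (i, j, a, b, c, e), fun _ ↦ rfl, fun _ ↦ rfl⟩ _ _ fun x ↦ ?_
  simp only [Equiv.coe_fn_mk]
  rw [hT x.2.1, hA x.2.2.2.2.2]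
  ring

lemma sum_mul_wick_eq_tensorPairing (hT : ∀ k i j, T k i j = T k j i)
    (hA : ∀ i j, A i j = A j i) :
    ∑ i, ∑ j, ∑ m, ∑ n, (∑ a, ∑ b, T i m a * A a b * T j b n) *
        (A i j * A m n + A i m * A j n + A i n * A j m) =
      tensorPairing T (fun i j k l m n ↦ A k n * A i l * A j m)
      + tensorPairing T (fun i j k l m n ↦ A i k * A l n * A j m)
      + tensorPairing T (fun i j k l m n ↦ A k m * A j n * A i l) := by
  simp only [Finset.sum_mul, tensorPairing, mul_add, Finset.sum_add_distrib]
  simp only [sum_six_eq_sum_prod]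
  refine congrArg₂ _ (congrArg₂ _ ?_ ?_) ?_
  · refine Fintype.sum_equiv ⟨fun (i, j, m, n, a, b) ↦ (m, a, i, n, b, j),
      fun (m, a, i, n, b, j) ↦ (i, j, m, n, a, b), fun _ ↦ rfl, fun _ ↦ rfl⟩ _ _ fun x ↦ ?_
    simp only [Equiv.coe_fn_mk]
    rw [hT x.2.1]
    ring
  · refine Fintype.sum_equiv ⟨fun (i, j, m, n, a, b) ↦ (m, a, i, n, b, j),
      fun (m, a, i, n, b, j) ↦ (i, j, m, n, a, b), fun _ ↦ rfl, fun _ ↦ rfl⟩ _ _ fun x ↦ ?_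
    simp only [Equiv.coe_fn_mk]
    rw [hT x.2.1, hA x.1 x.2.2.1, hA x.2.1 x.2.2.2.1]
    ring
  · refine Fintype.sum_equiv ⟨fun (i, j, m, n, a, b) ↦ (a, m, i, b, n, j),
      fun (a, m, i, b, n, j) ↦ (i, j, m, n, a, b), fun _ ↦ rfl, fun _ ↦ rfl⟩ _ _ fun x ↦ ?_
    simp only [Equiv.coe_fn_mk]
    rw [hT x.1, hA x.2.1 x.2.2.1]
    ring

/-- Contraction of a symmetric `T` with a vector `b` over the three pairings. -/
lemma sum_mul_vec_wick (hT : ∀ k i j, T k i j = T k j i)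
    (hu : ∀ i, u i = ∑ k, ∑ j, T k i j * A j k) (hv : ∀ k, v k = ∑ i, ∑ j, T k i j * A i j)
    (b : ι → ℝ) :
    ∑ i, ∑ j, ∑ k, ∑ l, T k i j * b l * (A i j * A k l + A i k * A j l + A i l * A j k) =
      v ⬝ᵥ A *ᵥ b + 2 * (u ⬝ᵥ A *ᵥ b) := by
  have h₁ : ∑ i, ∑ j, ∑ k, ∑ l, T k i j * b l * (A i j * A k l) = v ⬝ᵥ A *ᵥ b := by
    simp only [dotProduct, Matrix.mulVec, hv, Finset.sum_mul]
    simp only [Finset.mul_sum, sum_four_eq_sum_prod]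
    refine Fintype.sum_equiv ⟨fun (i, j, k, l) ↦ (k, i, j, l),
      fun (k, i, j, l) ↦ (i, j, k, l), fun _ ↦ rfl, fun _ ↦ rfl⟩ _ _ fun x ↦ ?_
    simp only [Equiv.coe_fn_mk]
    ring
  have h₂ : ∑ i, ∑ j, ∑ k, ∑ l, T k i j * b l * (A i k * A j l) = u ⬝ᵥ A *ᵥ b := by
    simp only [dotProduct, Matrix.mulVec, hu, Finset.sum_mul]
    simp only [Finset.mul_sum, sum_four_eq_sum_prod]
    refine Fintype.sum_equiv ⟨fun (i, j, k, l) ↦ (j, k, i, l),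
      fun (j, k, i, l) ↦ (i, j, k, l), fun _ ↦ rfl, fun _ ↦ rfl⟩ _ _ fun x ↦ ?_
    simp only [Equiv.coe_fn_mk]
    rw [hT _ x.1]
    ring
  have h₃ : ∑ i, ∑ j, ∑ k, ∑ l, T k i j * b l * (A i l * A j k) = u ⬝ᵥ A *ᵥ b := by
    rw [← h₂, Finset.sum_comm]
    congr! 4 with i _ j _ k _ l
    rw [hT]
    ring
  simp only [mul_add, Finset.sum_add_distrib, h₁, h₂, h₃]
  ring

end TensorContractions

section GaussianMeans

open MvPolynomial Matrix

variable {d : ℕ}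

/-- `f` is a polynomial function whose integral against the Gaussian density is `m`. -/
def HasGaussMoment {A : Matrix (Fin d) (Fin d) ℝ} (hA : A.PosDef)
    (f : (Fin d → ℝ) → ℝ) (m : ℝ) : Prop :=
  ∃ P : MvPolynomial (Fin d) ℝ, (∀ ξ, f ξ = eval ξ P) ∧ gaussMoment hA P = m

namespace HasGaussMoment

variable {A : Matrix (Fin d) (Fin d) ℝ} {hA : A.PosDef} {f g : (Fin d → ℝ) → ℝ} {m n : ℝ}

lemma integral_eq (h : HasGaussMoment hA f m) : ∫ ξ, f ξ * gaussDensity d A ξ = m := by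
  obtain ⟨P, hP, rfl⟩ := h
  simp only [hP, gaussMoment_apply]

lemma congr_left (h : HasGaussMoment hA f m) (hfg : ∀ ξ, g ξ = f ξ) : HasGaussMoment hA g m := by
  rwa [funext hfg]

lemma congr_right (h : HasGaussMoment hA f m) (hmn : m = n) : HasGaussMoment hA f n := hmn ▸ h

lemma add (hf : HasGaussMoment hA f m) (hg : HasGaussMoment hA g n) :
    HasGaussMoment hA (fun ξ ↦ f ξ + g ξ) (m + n) := by
  obtain ⟨P, hP, rfl⟩ := hf
  obtain ⟨Q, hQ, rfl⟩ := hg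
  exact ⟨P + Q, by simp [hP, hQ], map_add _ _ _⟩

lemma const_mul (c : ℝ) (hf : HasGaussMoment hA f m) :
    HasGaussMoment hA (fun ξ ↦ c * f ξ) (c * m) := by
  obtain ⟨P, hP, rfl⟩ := hf
  exact ⟨c • P, by simp [hP, smul_eval], map_smul _ _ _⟩

lemma sub (hf : HasGaussMoment hA f m) (hg : HasGaussMoment hA g n) :
    HasGaussMoment hA (fun ξ ↦ f ξ - g ξ) (m - n) := by
  obtain ⟨P, hP, rfl⟩ := hf
  obtain ⟨Q, hQ, rfl⟩ := hg
  exact ⟨P - Q, by simp [hP, hQ], map_sub _ _ _⟩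

lemma sum {ι : Type*} [Fintype ι] {f : ι → (Fin d → ℝ) → ℝ} {m : ι → ℝ}
    (h : ∀ i, HasGaussMoment hA (f i) (m i)) :
    HasGaussMoment hA (fun ξ ↦ ∑ i, f i ξ) (∑ i, m i) := by
  choose P hP hm using h
  exact ⟨∑ i, P i, by simp [hP], by simp [hm]⟩

variable (hA)

lemma const (c : ℝ) : HasGaussMoment hA (fun _ ↦ c) (c * gaussMoment hA 1) :=
  ⟨c • 1, by simp [smul_eval], by simp⟩

lemma two (c : ℝ) (i j : Fin d) :
    HasGaussMoment hA (fun ξ ↦ c * ξ i * ξ j) (c * (2 * A i j) * gaussMoment hA 1) :=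
  ⟨c • (X i * X j), by simp [smul_eval, mul_assoc], by simp [gaussMoment_two, mul_assoc]⟩

lemma four (c : ℝ) (i j k l : Fin d) :
    HasGaussMoment hA (fun ξ ↦ c * ξ i * ξ j * ξ k * ξ l)
      (c * (4 * (A i j * A k l + A i k * A j l + A i l * A j k)) * gaussMoment hA 1) :=
  ⟨c • (X i * X j * X k * X l), by simp [smul_eval, mul_assoc],
    by rw [map_smul, gaussMoment_four, smul_eq_mul]; simp only [mul_assoc]⟩

lemma six (c : ℝ) (i j k l m n : Fin d) :
    HasGaussMoment hA (fun ξ ↦ c * ξ i * ξ j * ξ k * ξ l * ξ m * ξ n)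
      (c * (8 * (A i j * (A k l * A m n + A k m * A l n + A k n * A l m)
        + A i k * (A j l * A m n + A j m * A l n + A j n * A l m)
        + A i l * (A j k * A m n + A j m * A k n + A j n * A k m)
        + A i m * (A j k * A l n + A j l * A k n + A j n * A k l)
        + A i n * (A j k * A l m + A j l * A k m + A j m * A k l))) * gaussMoment hA 1) :=
  ⟨c • (X i * X j * X k * X l * X m * X n), by simp [smul_eval, mul_assoc],
    by rw [map_smul, gaussMoment_six, smul_eq_mul]; simp only [mul_assoc]⟩

end HasGaussMoment

variable {A : Matrix (Fin d) (Fin d) ℝ} {T : Fin d → Matrix (Fin d) (Fin d) ℝ} {u v : Fin d → ℝ}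

/-- Second moment of the cubic polynomial `𝒜^{1/2}`, in terms of contractions. -/
lemma hasGaussMoment_cubic_sq (hA : A.PosDef) (hAs : ∀ i j, A i j = A j i)
    (hT : ∀ k i j, T k i j = T k j i)
    (hu : ∀ i, u i = ∑ k, ∑ j, T k i j * A j k) (hv : ∀ k, v k = ∑ i, ∑ j, T k i j * A i j)
    (α : ℝ) :
    HasGaussMoment hA
      (fun ξ ↦ (-(α/4) * (∑ i, ∑ j, ∑ k, T k i j * ξ i * ξ j * ξ k)
        + (α/2) * (∑ i, v i * ξ i) + α * (∑ i, u i * ξ i)) ^ 2)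
      (α ^ 2 * (tensorPairing T (fun i j k l m n ↦ A k n * A i l * A j m)
        + 2 * tensorPairing T (fun i j k l m n ↦ A k m * A j n * A i l)) * gaussMoment hA 1) := by
  set b : Fin d → ℝ := (α / 2) • v + α • u with hb
  have hsq : ∀ ξ : Fin d → ℝ, (-(α/4) * (∑ i, ∑ j, ∑ k, T k i j * ξ i * ξ j * ξ k)
        + (α/2) * (∑ i, v i * ξ i) + α * (∑ i, u i * ξ i)) ^ 2 =
      (α ^ 2 / 16) * (∑ i, ∑ j, ∑ k, ∑ l, ∑ m, ∑ n,
        T k i j * T n l m * ξ i * ξ j * ξ k * ξ l * ξ m * ξ n)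
      + (-(α / 2)) * (∑ i, ∑ j, ∑ k, ∑ l, T k i j * b l * ξ i * ξ j * ξ k * ξ l)
      + ∑ i, ∑ j, b i * b j * ξ i * ξ j := fun ξ ↦ by
    have h6 : ∑ i, ∑ j, ∑ k, ∑ l, ∑ m, ∑ n,
        T k i j * T n l m * ξ i * ξ j * ξ k * ξ l * ξ m * ξ n
        = (∑ i, ∑ j, ∑ k, T k i j * ξ i * ξ j * ξ k) ^ 2 := by
      rw [sq]
      simp only [Finset.sum_mul]
      simp only [Finset.mul_sum]
      congr! 6
      ring
    have h4 : ∑ i, ∑ j, ∑ k, ∑ l, T k i j * b l * ξ i * ξ j * ξ k * ξ l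
        = (∑ i, ∑ j, ∑ k, T k i j * ξ i * ξ j * ξ k) * ∑ l, b l * ξ l := by
      simp only [Finset.sum_mul]
      simp only [Finset.mul_sum]
      congr! 4
      ring
    have h2 : ∑ i, ∑ j, b i * b j * ξ i * ξ j = (∑ l, b l * ξ l) ^ 2 := by
      rw [sq, Finset.sum_mul_sum]
      congr! 2
      ring
    have hl : ∑ l, b l * ξ l = (α/2) * (∑ i, v i * ξ i) + α * (∑ i, u i * ξ i) := by
      simp [hb, add_mul, Finset.sum_add_distrib, Finset.mul_sum, mul_assoc]
    rw [h6, h4, h2, hl]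
    ring
  refine HasGaussMoment.congr_right (.congr_left (.add (.add (.const_mul _ (.sum fun i ↦
    .sum fun j ↦ .sum fun k ↦ .sum fun l ↦ .sum fun m ↦ .sum fun n ↦ .six hA _ _ _ _ _ _ _))
    (.const_mul _ (.sum fun i ↦ .sum fun j ↦ .sum fun k ↦ .sum fun l ↦ .four hA _ _ _ _ _)))
    (.sum fun i ↦ .sum fun j ↦ .two hA _ _ _)) hsq) ?_
  have e6 := tensorPairing_wick hT hAs
  rw [tensorPairing_trace_trace hv, tensorPairing_div_trace hT hu hv,
    tensorPairing_div_div hT hu, tensorPairing] at e6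
  have e4 := sum_mul_vec_wick hT hu hv b
  have e2 : ∑ i, ∑ j, b i * b j * A i j = b ⬝ᵥ A *ᵥ b := by
    simp only [dotProduct, Matrix.mulVec, Finset.mul_sum]
    congr! 2
    ring
  have hsymm : v ⬝ᵥ A *ᵥ u = u ⬝ᵥ A *ᵥ v := by
    rw [Matrix.dotProduct_mulVec, ← Matrix.mulVec_transpose, dotProduct_comm,
      show Aᵀ = A from Matrix.ext fun i j ↦ hAs j i]
  simp only [mul_left_comm _ (8 : ℝ), mul_left_comm _ (4 : ℝ), mul_left_comm _ (2 : ℝ),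
    ← Finset.sum_mul, ← Finset.mul_sum, e6, e4, e2]
  simp only [hb, Matrix.mulVec_add, Matrix.mulVec_smul, dotProduct_add, add_dotProduct,
    dotProduct_smul, smul_dotProduct, smul_eq_mul, hsymm]
  ring

end GaussianMeans

section MatrixIdentities

open Matrix

variable {ι : Type*} [Fintype ι] {A G : Matrix ι ι ℝ}

lemma sum_mul_mul_eq_mul_apply (G N : Matrix ι ι ℝ) (i j : ι) :
    ∑ a, ∑ b, G i a * N a b * G b j = (G * N * G) i j := by
  simp only [Matrix.mul_apply, Finset.sum_mul]
  exact Finset.sum_comm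

lemma sum_vec_mul_eq_dotProduct (hA : ∀ i j, A i j = A j i) {T : ι → Matrix ι ι ℝ} {u : ι → ℝ}
    (hu : ∀ i, u i = ∑ k, ∑ j, T k i j * A j k) (w : ι → ℝ) :
    ∑ k, ∑ j, (∑ i, w i * T k i j) * A k j = w ⬝ᵥ u := by
  simp only [dotProduct, hu, Finset.mul_sum, Finset.sum_mul]
  rw [Finset.sum_comm_cycle]
  congr! 3 with i _ k _ j _
  rw [hA k j]
  ring

variable [DecidableEq ι]

lemma sum_mul_eq_sum_mul_mul (hGA : G * A = 1) (hA : ∀ i j, A i j = A j i) (N : Matrix ι ι ℝ) :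
    ∑ a, ∑ b, G a b * N b a = ∑ a, ∑ b, (G * N * G) a b * A a b := by
  have h : (G * N * G * A).trace = (G * N).trace := by
    rw [Matrix.mul_assoc _ G A, hGA, Matrix.mul_one]
  simp only [Matrix.trace, Matrix.diag, Matrix.mul_apply (M := G * N * G),
    Matrix.mul_apply (M := G) (N := N)] at h
  rw [← h]
  congr! 3 with a _ b
  rw [hA]

lemma mulVec_div_eq_sum (hGA : G * A = 1) (N : ι → Matrix ι ι ℝ) (i : ι) :
    (G *ᵥ fun j ↦ ∑ l, N l j l) i = ∑ l, ∑ a, (G * N l * G) i a * A a l := by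
  simp only [← Matrix.mul_apply, Matrix.mul_assoc _ G A, hGA, Matrix.mul_one]
  simp only [Matrix.mulVec, dotProduct, Matrix.mul_apply, Finset.mul_sum]
  exact Finset.sum_comm

lemma sum_five_mul_eq_sum (hGA : G * A = 1) (M N : Matrix ι ι ℝ) (m n : ι) :
    ∑ a, ∑ b, ∑ c, ∑ e, G m a * M a b * G b c * N c e * G e n =
      ∑ a, ∑ b, (G * M * G) m a * A a b * (G * N * G) b n := by
  have h : (G * M * G * A * (G * N * G)) m n = (G * (M * (G * (N * G)))) m n := by
    simp only [Matrix.mul_assoc]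
    rw [← Matrix.mul_assoc A, ← Matrix.mul_assoc G (A * G), ← Matrix.mul_assoc G A, hGA,
      Matrix.one_mul]
  trans (G * (M * (G * (N * G)))) m n
  · simp only [Matrix.mul_apply, Finset.mul_sum, mul_assoc]
  · rw [← h]
    simp only [Matrix.mul_apply (N := G * N * G), Matrix.mul_apply (N := A), Finset.sum_mul]
    exact Finset.sum_comm

lemma sum_four_mul_eq_sum (hGA : G * A = 1) (M N : Matrix ι ι ℝ) :
    ∑ a, ∑ b, ∑ c, ∑ e, G a b * M b c * G c e * N e a =
      ∑ a, ∑ b, ∑ c, ∑ e, (G * M * G) a b * A b c * (G * N * G) c e * A e a := by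
  have h : (G * M * G * (A * (G * N * G * A))).trace = (G * (M * (G * N))).trace := by
    rw [Matrix.mul_assoc _ G A, hGA, Matrix.mul_one, Matrix.mul_assoc _ G, ← Matrix.mul_assoc G A,
      hGA, Matrix.one_mul]
    simp only [Matrix.mul_assoc]
  trans (G * (M * (G * N))).trace
  · simp only [Matrix.trace, Matrix.diag, Matrix.mul_apply, Finset.mul_sum, mul_assoc]
  · rw [← h]
    simp only [Matrix.trace, Matrix.diag, Matrix.mul_apply (M := G * M * G),
      Matrix.mul_apply (M := A), Matrix.mul_apply (M := G * N * G), Finset.mul_sum]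
    congr! 4
    ring

/-- Contracting the second-derivative quartic over the three pairings. -/
lemma sum_hessian_wick (hGA : G * A = 1) (hAG : A * G = 1) (hA : ∀ i j, A i j = A j i)
    (N : ι → ι → Matrix ι ι ℝ) (hN : ∀ i j a b, N i j a b = N i j b a) :
    ∑ i, ∑ j, ∑ l, ∑ m, (G * N i j * G) l m * (A i j * A l m + A i l * A j m + A i m * A j l) =
      ∑ i, ∑ j, (∑ a, ∑ b, G a b * N i j b a) * A i j + 2 * ∑ i, ∑ j, N i j i j := by
  have hAHA : ∀ i j p q, ∑ l, ∑ m, (G * N i j * G) l m * (A p l * A q m) = N i j p q := by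
    intro i j p q
    trans (A * ((G * N i j * G) * A)) p q
    · simp only [Matrix.mul_apply (M := A), Matrix.mul_apply (N := A), Finset.mul_sum]
      congr! 2 with l _ m
      rw [hA q m]
      ring
    · rw [Matrix.mul_assoc _ G, hGA, Matrix.mul_one, ← Matrix.mul_assoc, hAG, Matrix.one_mul]
  have hAHA' : ∀ i j p q, ∑ l, ∑ m, (G * N i j * G) l m * (A p m * A q l) = N i j q p := by
    intro i j p q
    rw [← hAHA i j q p]
    congr! 3
    ring
  have h₁ : ∑ i, ∑ j, ∑ l, ∑ m, (G * N i j * G) l m * (A i j * A l m) =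
      ∑ i, ∑ j, (∑ a, ∑ b, G a b * N i j b a) * A i j := by
    simp only [sum_mul_eq_sum_mul_mul hGA hA, Finset.sum_mul]
    congr! 4
    ring
  simp only [mul_add, Finset.sum_add_distrib, h₁, hAHA, hAHA', fun i j ↦ hN i j j i]
  ring

lemma sum_div_hessian_mul (hGA : G * A = 1)
    (N : ι → ι → Matrix ι ι ℝ) (hN : ∀ i j a b, N i j a b = N i j b a) :
    ∑ j, ∑ l, (∑ i, ∑ k, G i j * N k l i k) * A j l = ∑ i, ∑ j, N i j i j := by
  have h : ∀ l, ∑ j, (∑ i, ∑ k, G i j * N k l i k) * A j l = ∑ k, N k l k l := by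
    intro l
    trans ∑ i, (G * A) i l * ∑ k, N k l i k
    · simp only [Matrix.mul_apply, Finset.sum_mul]
      rw [Finset.sum_comm]
      congr! 2
      rw [Finset.mul_sum, Finset.sum_congr rfl]
      intros
      ring
    · simp only [hGA, Matrix.one_apply, ite_mul, one_mul, zero_mul, Finset.sum_ite_eq',
        Finset.mem_univ, if_true]
      exact Finset.sum_congr rfl fun k _ ↦ hN _ _ _ _
  rw [Finset.sum_comm]
  simp only [h]
  exact Finset.sum_comm

lemma sum_jacobian_mul (hGA : G * A = 1) (hA : ∀ i j, A i j = A j i) (J : Matrix ι ι ℝ) :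
    ∑ k, ∑ j, (∑ i, J i k * G i j) * A k j = ∑ i, J i i := by
  have h : ∀ i k, ∑ j, G i j * A k j = if i = k then 1 else 0 := by
    intro i k
    rw [← Matrix.one_apply, ← hGA, Matrix.mul_apply]
    congr! 2
    exact hA _ _
  calc _ = ∑ k, ∑ i, J i k * ∑ j, G i j * A k j := by
        simp only [Finset.sum_mul, Finset.mul_sum, mul_assoc]
        exact Finset.sum_congr rfl fun k _ ↦ Finset.sum_comm
    _ = _ := by simp [h]

end MatrixIdentities

section Expansion

open MvPolynomial Matrix Topology

variable {d : ℕ} {D : (Fin d → ℝ) → Matrix (Fin d) (Fin d) ℝ} {F : (Fin d → ℝ) → Fin d → ℝ}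
  {x₀ : Fin d → ℝ}

lemma Filter.EventuallyEq.pd_eq {f g : (Fin d → ℝ) → ℝ} (h : f =ᶠ[𝓝 x₀] g) (k : Fin d) :
    pd f k x₀ = pd g k x₀ := by
  rw [pd, pd, h.fderiv_eq]

lemma Filter.EventuallyEq.pd2_eq {f g : (Fin d → ℝ) → ℝ} (h : f =ᶠ[𝓝 x₀] g) (i j : Fin d) :
    pd2 f i j x₀ = pd2 g i j x₀ :=
  Filter.EventuallyEq.pd_eq (h.eventuallyEq_nhds.mono fun _ hy ↦ hy.pd_eq j) i

/-- The matrix `∂_k D` at `x₀`. -/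
noncomputable def pdMatrix (D : (Fin d → ℝ) → Matrix (Fin d) (Fin d) ℝ) (x₀ : Fin d → ℝ)
    (k : Fin d) : Matrix (Fin d) (Fin d) ℝ :=
  .of fun a b ↦ pd (fun x ↦ D x a b) k x₀

/-- The matrix `∂_i ∂_j D` at `x₀`. -/
noncomputable def pd2Matrix (D : (Fin d → ℝ) → Matrix (Fin d) (Fin d) ℝ) (x₀ : Fin d → ℝ)
    (i j : Fin d) : Matrix (Fin d) (Fin d) ℝ :=
  .of fun a b ↦ pd2 (fun x ↦ D x a b) i j x₀

/-- The tensor `D⁻¹ (∂_k D) D⁻¹` at `x₀`. -/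
noncomputable def logTensor (D : (Fin d → ℝ) → Matrix (Fin d) (Fin d) ℝ) (x₀ : Fin d → ℝ)
    (k : Fin d) : Matrix (Fin d) (Fin d) ℝ :=
  (D x₀)⁻¹ * pdMatrix D x₀ k * (D x₀)⁻¹

/-- The vector `D⁻¹_{ij} ∂_l D^{jl}` at `x₀`. -/
noncomputable def logDiv (D : (Fin d → ℝ) → Matrix (Fin d) (Fin d) ℝ) (x₀ : Fin d → ℝ) :
    Fin d → ℝ :=
  (D x₀)⁻¹ *ᵥ fun j ↦ ∑ l, pdMatrix D x₀ l j l

/-- The vector `tr (D⁻¹ ∂_k D)` at `x₀`, written as a contraction of `logTensor`. -/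
noncomputable def logTrace (D : (Fin d → ℝ) → Matrix (Fin d) (Fin d) ℝ) (x₀ : Fin d → ℝ)
    (k : Fin d) : ℝ :=
  ∑ a, ∑ b, logTensor D x₀ k a b * D x₀ a b

lemma Matrix.PosDef.apply_comm {A : Matrix (Fin d) (Fin d) ℝ} (hA : A.PosDef) (i j : Fin d) :
    A i j = A j i := by
  simpa using (hA.isHermitian.apply i j).symm

lemma Matrix.PosDef.inv_mul_self {A : Matrix (Fin d) (Fin d) ℝ} (hA : A.PosDef) : A⁻¹ * A = 1 :=
  Matrix.nonsing_inv_mul _ hA.det_pos.ne'.isUnit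

lemma Matrix.PosDef.mul_inv_self {A : Matrix (Fin d) (Fin d) ℝ} (hA : A.PosDef) : A * A⁻¹ = 1 :=
  Matrix.mul_nonsing_inv _ hA.det_pos.ne'.isUnit

lemma sum_inv_mul_pd_mul_inv (k i j : Fin d) :
    ∑ a, ∑ b, (D x₀)⁻¹ i a * pd (fun x ↦ D x a b) k x₀ * (D x₀)⁻¹ b j = logTensor D x₀ k i j :=
  sum_mul_mul_eq_mul_apply _ (pdMatrix D x₀ k) i j

lemma sum_inv_mul_pd (hA : (D x₀).PosDef) (k : Fin d) :
    ∑ a, ∑ b, (D x₀)⁻¹ a b * pd (fun x ↦ D x b a) k x₀ = logTrace D x₀ k :=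
  sum_mul_eq_sum_mul_mul hA.inv_mul_self hA.apply_comm (pdMatrix D x₀ k)

lemma sum_inv_mul_div (i : Fin d) :
    ∑ j, ∑ l, (D x₀)⁻¹ i j * pd (fun x ↦ D x j l) l x₀ = logDiv D x₀ i := by
  simp only [logDiv, Matrix.mulVec, dotProduct, Finset.mul_sum, pdMatrix, Matrix.of_apply]

lemma logDiv_eq_sum (hA : (D x₀).PosDef) (i : Fin d) :
    logDiv D x₀ i = ∑ k, ∑ j, logTensor D x₀ k i j * D x₀ j k :=
  mulVec_div_eq_sum hA.inv_mul_self _ i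

lemma mulVec_logDiv (hA : (D x₀).PosDef) :
    D x₀ *ᵥ logDiv D x₀ = fun j ↦ ∑ l, pdMatrix D x₀ l j l := by
  rw [logDiv, Matrix.mulVec_mulVec, hA.mul_inv_self, Matrix.one_mulVec]

lemma logTensor_comm (hA : (D x₀).PosDef)
    (hD : ∀ k a b, pd (fun x ↦ D x a b) k x₀ = pd (fun x ↦ D x b a) k x₀) (k i j : Fin d) :
    logTensor D x₀ k i j = logTensor D x₀ k j i := by
  rw [← sum_inv_mul_pd_mul_inv, ← sum_inv_mul_pd_mul_inv, Finset.sum_comm]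
  congr! 2 with a _ b
  rw [hD, hA.inv.apply_comm i, hA.inv.apply_comm a]
  ring

lemma hasGaussMoment_Ahalf_sq (hA : (D x₀).PosDef)
    (hD : ∀ k a b, pd (fun x ↦ D x a b) k x₀ = pd (fun x ↦ D x b a) k x₀) (α : ℝ) :
    HasGaussMoment hA (fun ξ ↦ (Ahalf d α D x₀ ξ) ^ 2)
      (α ^ 2 * (tensorPairing (logTensor D x₀) (fun i j k l m n ↦ D x₀ k n * D x₀ i l * D x₀ j m)
        + 2 * tensorPairing (logTensor D x₀) (fun i j k l m n ↦ D x₀ k m * D x₀ j n * D x₀ i l))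
        * gaussMoment hA 1) := by
  refine (hasGaussMoment_cubic_sq hA hA.apply_comm (logTensor_comm hA hD) (logDiv_eq_sum hA)
    (v := logTrace D x₀) (fun _ ↦ rfl) α).congr_left fun ξ ↦ ?_
  simp only [Ahalf, sum_inv_mul_pd_mul_inv, sum_inv_mul_pd hA, sum_inv_mul_div]

lemma hasGaussMoment_A11 (hA : (D x₀).PosDef) (α : ℝ) :
    HasGaussMoment hA (A11 d α D F x₀) 0 := by
  refine HasGaussMoment.congr_right (.add (.const_mul _ (.sum fun i ↦ .sum fun j ↦ .sum fun k ↦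
    .two hA _ i j)) (.const hA _)) ?_
  simp only [sum_inv_mul_pd_mul_inv, sum_inv_mul_pd hA, logTrace, ← Finset.sum_mul,
    mul_left_comm _ (2 : ℝ), ← Finset.mul_sum]
  have h : ∑ i, ∑ j, (∑ k, logTensor D x₀ k i j * F x₀ k) * D x₀ i j =
      ∑ k, (∑ i, ∑ j, logTensor D x₀ k i j * D x₀ i j) * F x₀ k := by
    simp only [Finset.sum_mul]
    rw [Finset.sum_comm_cycle]
    congr! 3
    ring
  rw [h]
  ring

lemma hasGaussMoment_A12 (hA : (D x₀).PosDef) (α : ℝ) :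
    HasGaussMoment hA (A12 d α D F x₀)
      (-α * (∑ i, pd (fun x ↦ F x i) i x₀) * gaussMoment hA 1) := by
  refine HasGaussMoment.congr_right (.const_mul _ (.sum fun k ↦ .sum fun j ↦ .two hA _ k j)) ?_
  have h := sum_jacobian_mul hA.inv_mul_self hA.apply_comm
    (.of fun i k ↦ pd (fun x ↦ F x i) k x₀)
  simp only [Matrix.of_apply] at h
  simp only [← Finset.sum_mul, mul_left_comm _ (2 : ℝ), ← Finset.mul_sum, h]
  ring

lemma hasGaussMoment_A13 (hA : (D x₀).PosDef)
    (hD : ∀ i j a b, pd2 (fun x ↦ D x a b) i j x₀ = pd2 (fun x ↦ D x b a) i j x₀) (α : ℝ) :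
    HasGaussMoment hA (A13 d α D x₀)
      (α ^ 2 * (∑ i, ∑ j, pd2 (fun x ↦ D x i j) i j x₀) * gaussMoment hA 1) := by
  refine HasGaussMoment.congr_right (.add (.add (.const_mul _ (.sum fun i ↦ .sum fun j ↦
    .sum fun l ↦ .sum fun m ↦ .four hA _ i j l m)) (.const_mul _ (.sum fun j ↦ .sum fun l ↦
    .two hA _ j l))) (.const_mul _ (.sum fun i ↦ .sum fun j ↦ .two hA _ i j))) ?_
  have h₁ := sum_hessian_wick hA.inv_mul_self hA.mul_inv_self hA.apply_comm (pd2Matrix D x₀) hD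
  have h₂ := sum_div_hessian_mul hA.inv_mul_self (pd2Matrix D x₀) hD
  simp only [← sum_mul_mul_eq_mul_apply] at h₁
  simp only [pd2Matrix, Matrix.of_apply] at h₁ h₂
  simp only [← Finset.mul_sum] at h₂
  simp only [← Finset.sum_mul, mul_left_comm _ (2 : ℝ), mul_left_comm _ (4 : ℝ),
    ← Finset.mul_sum, h₁, h₂]
  ring

lemma hasGaussMoment_A14 (hA : (D x₀).PosDef)
    (hD : ∀ k a b, pd (fun x ↦ D x a b) k x₀ = pd (fun x ↦ D x b a) k x₀) (α : ℝ) :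
    HasGaussMoment hA (A14 d α D x₀)
      (α ^ 2 / 2 *
        (tensorPairing (logTensor D x₀) (fun i j k l m n ↦ D x₀ k n * D x₀ i l * D x₀ j m)
        + 2 * tensorPairing (logTensor D x₀) (fun i j k l m n ↦ D x₀ k m * D x₀ j n * D x₀ i l))
        * gaussMoment hA 1) := by
  refine HasGaussMoment.congr_right (.add (.sub (.sub (.const_mul _ (.sum fun i ↦ .sum fun j ↦
    .sum fun m ↦ .sum fun n ↦ .four hA _ i j m n)) (.const_mul _ (.sum fun i ↦ .sum fun j ↦
    .two hA _ i j))) (.const_mul _ (.sum fun k ↦ .sum fun j ↦ .two hA _ k j))) (.const hA _)) ?_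
  set w : Fin d → ℝ := fun j ↦ ∑ l, pdMatrix D x₀ l j l with hw
  have hT := logTensor_comm hA hD
  have h₅ : ∀ i j m n, ∑ a, ∑ b, ∑ c, ∑ e, (D x₀)⁻¹ m a * pd (fun x ↦ D x a b) i x₀ *
      (D x₀)⁻¹ b c * pd (fun x ↦ D x c e) j x₀ * (D x₀)⁻¹ e n =
      ∑ a, ∑ b, logTensor D x₀ i m a * D x₀ a b * logTensor D x₀ j b n := fun i j m n ↦
    sum_five_mul_eq_sum hA.inv_mul_self (pdMatrix D x₀ i) (pdMatrix D x₀ j) m n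
  have h₄ : ∀ i j, ∑ a, ∑ b, ∑ c, ∑ e, (D x₀)⁻¹ a b * pd (fun x ↦ D x b c) i x₀ *
      (D x₀)⁻¹ c e * pd (fun x ↦ D x e a) j x₀ =
      ∑ a, ∑ b, ∑ c, ∑ e, logTensor D x₀ i a b * D x₀ b c * logTensor D x₀ j c e * D x₀ e a :=
    fun i j ↦ sum_four_mul_eq_sum hA.inv_mul_self (pdMatrix D x₀ i) (pdMatrix D x₀ j)
  have h₁ : ∑ k, ∑ j, (∑ i, ∑ l, pd (fun x ↦ D x i l) l x₀ * logTensor D x₀ k i j) * D x₀ k j =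
      w ⬝ᵥ logDiv D x₀ := by
    simp only [← Finset.sum_mul]
    exact sum_vec_mul_eq_dotProduct hA.apply_comm (logDiv_eq_sum hA) w
  have h₀ : ∑ i, ∑ j, ∑ l, ∑ m, pd (fun x ↦ D x i l) l x₀ * (D x₀)⁻¹ i j *
      pd (fun x ↦ D x j m) m x₀ = w ⬝ᵥ logDiv D x₀ := by
    simp only [← Finset.mul_sum, ← Finset.sum_mul, logDiv, dotProduct, Matrix.mulVec]
    simp only [Finset.mul_sum, ← mul_assoc]
    rfl
  simp only [← Finset.sum_mul, ← Finset.mul_sum] at h₁ h₀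
  simp only [h₅, h₄, sum_inv_mul_pd_mul_inv, ← Finset.sum_mul, mul_left_comm _ (2 : ℝ),
    mul_left_comm _ (4 : ℝ), ← Finset.mul_sum, h₁, h₀,
    sum_mul_wick_eq_tensorPairing hT hA.apply_comm, sum_trace_mul_eq_tensorPairing hT hA.apply_comm]
  rw [tensorPairing_div_div hT (logDiv_eq_sum hA), mulVec_logDiv hA, ← hw, dotProduct_comm w]
  ring

end Expansion

/-- `⟨𝒜¹(ξ)⟩₀ − ½ ⟨(𝒜^{1/2}(ξ))²⟩₀ = 0`. -/
theorem Aone_mean_cancellation (d : ℕ) (hd : 1 ≤ d)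
    (U : Set (Fin d → ℝ)) (hU : IsOpen U) (x₀ : Fin d → ℝ) (hx₀ : x₀ ∈ U)
    (α : ℝ)
    (D : (Fin d → ℝ) → Matrix (Fin d) (Fin d) ℝ)
    (hsymm : ∀ x ∈ U, (D x).IsSymm) (hpos : ∀ x ∈ U, (D x).PosDef)
    (hC2 : ∀ i j, ContDiffOn ℝ 2 (fun x => D x i j) U)
    (F : (Fin d → ℝ) → Fin d → ℝ)
    (hF : ∀ i, ContDiffOn ℝ 1 (fun x => F x i) U) :
    (∫ ξ : Fin d → ℝ, Aone d α D F x₀ ξ * gaussDensity d (D x₀) ξ) -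
      (1/2) * (∫ ξ : Fin d → ℝ, (Ahalf d α D x₀ ξ)^2 * gaussDensity d (D x₀) ξ) = 0 := by
  have hA := hpos x₀ hx₀
  have hD : ∀ a b, (fun x ↦ D x a b) =ᶠ[nhds x₀] fun x ↦ D x b a := fun a b ↦
    Filter.eventually_of_mem (hU.mem_nhds hx₀) fun x hx ↦ (hsymm x hx).apply b a
  have hAone : HasGaussMoment hA (Aone d α D F x₀) _ :=
    (((((hasGaussMoment_A11 hA α).add (hasGaussMoment_A12 hA α)).add
      (hasGaussMoment_A13 hA (fun i j a b ↦ (hD a b).pd2_eq i j) α)).add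
      (hasGaussMoment_A14 hA (fun k a b ↦ (hD a b).pd_eq k) α)).add (.const hA _)).sub (.const hA _)
  rw [hAone.integral_eq,
    (hasGaussMoment_Ahalf_sq hA (fun k a b ↦ (hD a b).pd_eq k) α).integral_eq]
  ring
end
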